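/- For every z in the upper half-plane ℍ: Φ30(x1(z),…,x6(z)) = Δ(z)^2·E6(z). -/

import Mathlib

open Complex Finset

noncomputable section

/-- `ζ = exp(2πi/13)`. -/
def zeta13 : ℂ := Complex.exp (2 * Real.pi * Complex.I / 13)

local notation "ζ" => zeta13

/-- The diagonal matrix `T = diag(ζ^7, ζ^11, ζ^8, ζ^6, ζ^2, ζ^5)`. -/
def Tmat : Matrix (Fin 6) (Fin 6) ℂ :=
  Matrix.diagonal ![ζ ^ 7, ζ ^ 11, ζ ^ 8, ζ ^ 6, ζ ^ 2, ζ ^ 5]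

/-- The matrix `S = -(1/√13)·M`. -/
def Smat : Matrix (Fin 6) (Fin 6) ℂ :=
  (-(1 / (Real.sqrt 13 : ℂ))) • Matrix.of
    ![![ζ^12 - ζ, ζ^10 - ζ^3, ζ^4 - ζ^9, ζ^5 - ζ^8, ζ^2 - ζ^11, ζ^6 - ζ^7],
      ![ζ^10 - ζ^3, ζ^4 - ζ^9, ζ^12 - ζ, ζ^2 - ζ^11, ζ^6 - ζ^7, ζ^5 - ζ^8],
      ![ζ^4 - ζ^9, ζ^12 - ζ, ζ^10 - ζ^3, ζ^6 - ζ^7, ζ^5 - ζ^8, ζ^2 - ζ^11],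
      ![ζ^5 - ζ^8, ζ^2 - ζ^11, ζ^6 - ζ^7, ζ - ζ^12, ζ^3 - ζ^10, ζ^9 - ζ^4],
      ![ζ^2 - ζ^11, ζ^6 - ζ^7, ζ^5 - ζ^8, ζ^3 - ζ^10, ζ^9 - ζ^4, ζ - ζ^12],
      ![ζ^6 - ζ^7, ζ^5 - ζ^8, ζ^2 - ζ^11, ζ^9 - ζ^4, ζ - ζ^12, ζ^3 - ζ^10]]

/-- The matrix `H`, mapping `(z1,…,z6)` to `(z6, z4, z5, −z3, −z1, −z2)`. -/
def Hmat : Matrix (Fin 6) (Fin 6) ℂ :=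
  Matrix.of
    ![![0,0,0,0,0,1], ![0,0,0,1,0,0], ![0,0,0,0,1,0],
      ![0,0,-1,0,0,0], ![-1,0,0,0,0,0], ![0,-1,0,0,0,0]]

/-- The senary quadratic forms `A_0, …, A_6` (here `v 0 = z1, …, v 5 = z6`). -/
def A : ℕ → (Fin 6 → ℂ) → ℂ
  | 0, v => v 0 * v 3 + v 1 * v 4 + v 2 * v 5
  | 1, v => v 0 ^ 2 - 2 * v 2 * v 3
  | 2, v => -v 4 ^ 2 - 2 * v 1 * v 3
  | 3, v => v 1 ^ 2 - 2 * v 0 * v 4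
  | 4, v => v 2 ^ 2 - 2 * v 1 * v 5
  | 5, v => -v 3 ^ 2 - 2 * v 0 * v 5
  | 6, v => -v 5 ^ 2 - 2 * v 2 * v 4
  | _, _ => 0

/-- `w_ν = (A0 + ζ^ν A1 + ζ^{4ν} A2 + ζ^{9ν} A3 + ζ^{3ν} A4 + ζ^{12ν} A5 + ζ^{10ν} A6)^2`. -/
def w (ν : ℕ) (v : Fin 6 → ℂ) : ℂ :=
  (A 0 v + ζ ^ ν * A 1 v + ζ ^ (4 * ν) * A 2 v + ζ ^ (9 * ν) * A 3 v +
    ζ ^ (3 * ν) * A 4 v + ζ ^ (12 * ν) * A 5 v + ζ ^ (10 * ν) * A 6 v) ^ 2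

/-- `w_∞ = 13·A0^2`. -/
def winf (v : Fin 6 → ℂ) : ℂ := 13 * A 0 v ^ 2

/-- The senary cubic forms `D_0, …, D_12` (here `v 0 = z1, …, v 5 = z6`). -/
def D : ℕ → (Fin 6 → ℂ) → ℂ
  | 0, v => v 0 * v 1 * v 2
  | 1, v => 2 * v 1 * v 2 ^ 2 + v 1 ^ 2 * v 5 - v 3 ^ 2 * v 4 + v 0 * v 4 * v 5
  | 2, v => -v 5 ^ 3 + v 1 ^ 2 * v 3 - 2 * v 1 * v 4 ^ 2 + v 0 * v 3 * v 4 + 3 * v 2 * v 4 * v 5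
  | 3, v => 2 * v 0 * v 1 ^ 2 + v 0 ^ 2 * v 4 - v 3 * v 5 ^ 2 + v 2 * v 3 * v 4
  | 4, v => -v 1 ^ 2 * v 2 + v 0 * v 5 ^ 2 - 2 * v 3 ^ 2 * v 5 - v 0 * v 2 * v 4
  | 5, v => -v 3 ^ 3 + v 2 ^ 2 * v 4 - 2 * v 2 * v 5 ^ 2 + v 1 * v 4 * v 5 + 3 * v 0 * v 3 * v 5
  | 6, v => -v 4 ^ 3 + v 0 ^ 2 * v 5 - 2 * v 0 * v 3 ^ 2 + v 2 * v 3 * v 5 + 3 * v 1 * v 3 * v 4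
  | 7, v => -v 1 ^ 3 + v 2 * v 3 ^ 2 - v 0 * v 2 * v 5 - 3 * v 0 * v 1 * v 4 + 2 * v 0 ^ 2 * v 3
  | 8, v => -v 0 ^ 3 + v 1 * v 5 ^ 2 - v 1 * v 2 * v 4 - 3 * v 0 * v 2 * v 3 + 2 * v 2 ^ 2 * v 5
  | 9, v => 2 * v 0 ^ 2 * v 2 + v 2 ^ 2 * v 3 - v 4 ^ 2 * v 5 + v 1 * v 3 * v 5
  | 10, v => -v 0 * v 2 ^ 2 + v 1 * v 3 ^ 2 - 2 * v 3 * v 4 ^ 2 - v 0 * v 1 * v 5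
  | 11, v => -v 2 ^ 3 + v 0 * v 4 ^ 2 - v 0 * v 1 * v 3 - 3 * v 1 * v 2 * v 5 + 2 * v 1 ^ 2 * v 4
  | 12, v => -v 0 ^ 2 * v 1 + v 2 * v 4 ^ 2 - 2 * v 4 * v 5 ^ 2 - v 1 * v 2 * v 3
  | _, _ => 0

/-- The senary cubic form `D_∞ = z4 z5 z6`. -/
def Dinf (v : Fin 6 → ℂ) : ℂ := v 3 * v 4 * v 5

/-- The senary sextic forms `G_0, …, G_12`. -/
def Gs : ℕ → (Fin 6 → ℂ) → ℂ
  | 0, v => D 0 v ^ 2 + Dinf v ^ 2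
  | 1, v => -D 7 v ^ 2 + 2 * D 0 v * D 1 v + 10 * Dinf v * D 1 v + 2 * D 2 v * D 12 v
      - 2 * D 3 v * D 11 v - 4 * D 4 v * D 10 v - 2 * D 9 v * D 5 v
  | 2, v => -2 * D 1 v ^ 2 - 4 * D 0 v * D 2 v + 6 * Dinf v * D 2 v - 2 * D 4 v * D 11 v
      + 2 * D 5 v * D 10 v - 2 * D 6 v * D 9 v - 2 * D 7 v * D 8 v
  | 3, v => -D 8 v ^ 2 + 2 * D 0 v * D 3 v + 10 * Dinf v * D 3 v + 2 * D 6 v * D 10 v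
      - 2 * D 9 v * D 7 v - 4 * D 12 v * D 4 v - 2 * D 1 v * D 2 v
  | 4, v => -D 2 v ^ 2 + 10 * D 0 v * D 4 v - 2 * Dinf v * D 4 v + 2 * D 5 v * D 12 v
      - 2 * D 9 v * D 8 v - 4 * D 1 v * D 3 v - 2 * D 10 v * D 7 v
  | 5, v => -2 * D 9 v ^ 2 - 4 * D 0 v * D 5 v + 6 * Dinf v * D 5 v - 2 * D 10 v * D 8 v
      + 2 * D 6 v * D 12 v - 2 * D 2 v * D 3 v - 2 * D 11 v * D 7 v
  | 6, v => -2 * D 3 v ^ 2 - 4 * D 0 v * D 6 v + 6 * Dinf v * D 6 v - 2 * D 12 v * D 7 v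
      + 2 * D 2 v * D 4 v - 2 * D 5 v * D 1 v - 2 * D 8 v * D 11 v
  | 7, v => -2 * D 10 v ^ 2 + 6 * D 0 v * D 7 v + 4 * Dinf v * D 7 v - 2 * D 1 v * D 6 v
      - 2 * D 2 v * D 5 v - 2 * D 8 v * D 12 v - 2 * D 9 v * D 11 v
  | 8, v => -2 * D 4 v ^ 2 + 6 * D 0 v * D 8 v + 4 * Dinf v * D 8 v - 2 * D 3 v * D 5 v
      - 2 * D 6 v * D 2 v - 2 * D 11 v * D 10 v - 2 * D 1 v * D 7 v
  | 9, v => -D 11 v ^ 2 + 2 * D 0 v * D 9 v + 10 * Dinf v * D 9 v + 2 * D 5 v * D 4 v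
      - 2 * D 1 v * D 8 v - 4 * D 10 v * D 12 v - 2 * D 3 v * D 6 v
  | 10, v => -D 5 v ^ 2 + 10 * D 0 v * D 10 v - 2 * Dinf v * D 10 v + 2 * D 6 v * D 4 v
      - 2 * D 3 v * D 7 v - 4 * D 9 v * D 1 v - 2 * D 12 v * D 11 v
  | 11, v => -2 * D 12 v ^ 2 + 6 * D 0 v * D 11 v + 4 * Dinf v * D 11 v - 2 * D 9 v * D 2 v
      - 2 * D 5 v * D 6 v - 2 * D 7 v * D 4 v - 2 * D 3 v * D 8 v
  | 12, v => -D 6 v ^ 2 + 10 * D 0 v * D 12 v - 2 * Dinf v * D 12 v + 2 * D 2 v * D 10 v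
      - 2 * D 1 v * D 11 v - 4 * D 3 v * D 9 v - 2 * D 4 v * D 8 v
  | _, _ => 0

/-- `δ_ν = −13·G0 + Σ_{j=1}^{12} ζ^{jν} G_j`. -/
def deltaF (ν : ℕ) (v : Fin 6 → ℂ) : ℂ :=
  -13 * Gs 0 v + ∑ j ∈ Finset.Icc 1 12, ζ ^ (j * ν) * Gs j v

/-- `δ_∞ = 13^2·G0`. -/
def deltaInf (v : Fin 6 → ℂ) : ℂ := 13 ^ 2 * Gs 0 v

/-- `Φ4 = Σ_ν w_ν + w_∞`. -/
def Phi4 (v : Fin 6 → ℂ) : ℂ := (∑ ν ∈ Finset.range 13, w ν v) + winf v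

/-- `Φ8 = Σ_ν w_ν^2 + w_∞^2`. -/
def Phi8 (v : Fin 6 → ℂ) : ℂ := (∑ ν ∈ Finset.range 13, w ν v ^ 2) + winf v ^ 2

/-- `Φ12′ = −(1/(13·30))(Σ_ν w_ν^3 + w_∞^3)`. -/
def Phi12' (v : Fin 6 → ℂ) : ℂ :=
  -(1 / (13 * 30)) * ((∑ ν ∈ Finset.range 13, w ν v ^ 3) + winf v ^ 3)

/-- `Φ16 = Σ_ν w_ν^4 + w_∞^4`. -/
def Phi16 (v : Fin 6 → ℂ) : ℂ := (∑ ν ∈ Finset.range 13, w ν v ^ 4) + winf v ^ 4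

/-- `Φ20 = (1/(13·25))(Σ_ν w_ν^5 + w_∞^5)`. -/
def Phi20 (v : Fin 6 → ℂ) : ℂ :=
  (1 / (13 * 25)) * ((∑ ν ∈ Finset.range 13, w ν v ^ 5) + winf v ^ 5)

/-- `Φ12 = −(1/(13·52))(Σ_ν δ_ν^2 + δ_∞^2)`. -/
def Phi12 (v : Fin 6 → ℂ) : ℂ :=
  -(1 / (13 * 52)) * ((∑ ν ∈ Finset.range 13, deltaF ν v ^ 2) + deltaInf v ^ 2)

/-- `Φ18 = (1/(13·6))(Σ_ν δ_ν^3 + δ_∞^3)`. -/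
def Phi18 (v : Fin 6 → ℂ) : ℂ :=
  (1 / (13 * 6)) * ((∑ ν ∈ Finset.range 13, deltaF ν v ^ 3) + deltaInf v ^ 3)

/-- `Φ30 = −(1/(13·1315))(Σ_ν δ_ν^5 + δ_∞^5)`. -/
def Phi30 (v : Fin 6 → ℂ) : ℂ :=
  -(1 / (13 * 1315)) * ((∑ ν ∈ Finset.range 13, deltaF ν v ^ 5) + deltaInf v ^ 5)

/-- `q^α = exp(2πiαz)`. -/
def qp (α : ℚ) (z : ℂ) : ℂ := Complex.exp (2 * Real.pi * Complex.I * (α : ℂ) * z)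

/-- `Σ_{n∈ℤ} (−1)^n q^{(13n^2+cn)/2}`. -/
def thetaSum (c : ℤ) (z : ℂ) : ℂ :=
  ∑' n : ℤ, (-1 : ℂ) ^ n * qp ((13 * (n : ℚ) ^ 2 + (c : ℚ) * (n : ℚ)) / 2) z

/-- The theta constants of order 13: `a_1, …, a_6`. -/
def thc : ℕ → ℂ → ℂ
  | 1, z => qp (121 / 104) z * thetaSum 11 z
  | 2, z => qp (49 / 104) z * thetaSum 7 z
  | 3, z => qp (25 / 104) z * thetaSum 5 z
  | 4, z => -(qp (9 / 104) z * thetaSum 3 z)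
  | 5, z => qp (81 / 104) z * thetaSum 9 z
  | 6, z => qp (1 / 104) z * thetaSum 1 z
  | _, _ => 0

/-- The vector `A(z) = (a1(z), …, a6(z))`. -/
def Avec (z : ℂ) : Fin 6 → ℂ := fun i => thc (i.val + 1) z

/-- The Dedekind eta function `η(z) = q^{1/24} Π_{n=1}^∞ (1−q^n)`. -/
def etaF (z : ℂ) : ℂ :=
  qp (1 / 24) z * ∏' n : ℕ, (1 - Complex.exp (2 * Real.pi * Complex.I * z) ^ (n + 1))

/-- The vector `(x1(z), …, x6(z))` with `x_i(z) = η(z)·a_i(z)`. -/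
def X (z : ℂ) : Fin 6 → ℂ := fun i => etaF z * thc (i.val + 1) z

/-- The discriminant `Δ(z) = η(z)^24`. -/
def Delta (z : ℂ) : ℂ := etaF z ^ 24

/-- The Eisenstein series `E4(z) = (1/2) Σ_{gcd(m,n)=1} (mz+n)^{−4}`. -/
def E4 (z : ℂ) : ℂ :=
  (1 / 2) * ∑' p : {p : ℤ × ℤ // Int.gcd p.1 p.2 = 1},
    ((p.1.1 : ℂ) * z + (p.1.2 : ℂ)) ^ (-4 : ℤ)

/-- The Eisenstein series `E6(z) = (1/2) Σ_{gcd(m,n)=1} (mz+n)^{−6}`. -/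
def E6 (z : ℂ) : ℂ :=
  (1 / 2) * ∑' p : {p : ℤ × ℤ // Int.gcd p.1 p.2 = 1},
    ((p.1.1 : ℂ) * z + (p.1.2 : ℂ)) ^ (-6 : ℤ)

local notation "ψ" => (ZMod.stdAddChar : AddChar (ZMod 13) ℂ)

/-- The weighted scaling `z_i ↦ s ^ k_i * z_i`, where `k_i` is the exponent of `q ^ (1 / 13)` in the
`i`-th theta constant, up to a common factor. -/
def scaling (s : ℂ) (v : Fin 6 → ℂ) : Fin 6 → ℂ :=
  ![s ^ 15 * v 0, s ^ 6 * v 1, s ^ 3 * v 2, s * v 3, s ^ 10 * v 4, v 5]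

/-- The exponents of the lowest powers of `s` in `D_j (scaling s v)`; the index `13` stands for
`D_∞`. -/
def cubicOrder : ℕ → ℕ
  | 0 => 24
  | 1 => 12
  | 2 => 0
  | 3 => 1
  | 4 => 2
  | 5 => 3
  | 6 => 4
  | 7 => 5
  | 8 => 6
  | 9 => 7
  | 10 => 8
  | 11 => 9
  | 12 => 10
  | 13 => 11
  | _ => 0

/-- The cubic forms after scaling, divided by the lowest power of `s`, as functions of
`u = s ^ 13`. -/
def cubicNormalized (u : ℂ) (v : Fin 6 → ℂ) : ℕ → ℂ
  | 0 => v 0 * v 1 * v 2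
  | 1 => 2 * v 1 * v 2 ^ 2 + v 1 ^ 2 * v 5 - v 3 ^ 2 * v 4 + v 0 * v 4 * v 5 * u
  | 2 => -v 5 ^ 3 + v 1 ^ 2 * v 3 * u - 2 * v 1 * v 4 ^ 2 * u ^ 2 + v 0 * v 3 * v 4 * u ^ 2 +
      3 * v 2 * v 4 * v 5 * u
  | 3 => 2 * v 0 * v 1 ^ 2 * u ^ 2 + v 0 ^ 2 * v 4 * u ^ 3 - v 3 * v 5 ^ 2 + v 2 * v 3 * v 4 * u
  | 4 => -v 1 ^ 2 * v 2 * u + v 0 * v 5 ^ 2 * u - 2 * v 3 ^ 2 * v 5 - v 0 * v 2 * v 4 * u ^ 2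
  | 5 => -v 3 ^ 3 + v 2 ^ 2 * v 4 * u - 2 * v 2 * v 5 ^ 2 + v 1 * v 4 * v 5 * u +
      3 * v 0 * v 3 * v 5 * u
  | 6 => -v 4 ^ 3 * u ^ 2 + v 0 ^ 2 * v 5 * u ^ 2 - 2 * v 0 * v 3 ^ 2 * u + v 2 * v 3 * v 5 +
      3 * v 1 * v 3 * v 4 * u
  | 7 => -v 1 ^ 3 * u + v 2 * v 3 ^ 2 - v 0 * v 2 * v 5 * u - 3 * v 0 * v 1 * v 4 * u ^ 2 +
      2 * v 0 ^ 2 * v 3 * u ^ 2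
  | 8 => -v 0 ^ 3 * u ^ 3 + v 1 * v 5 ^ 2 - v 1 * v 2 * v 4 * u - 3 * v 0 * v 2 * v 3 * u +
      2 * v 2 ^ 2 * v 5
  | 9 => 2 * v 0 ^ 2 * v 2 * u ^ 2 + v 2 ^ 2 * v 3 - v 4 ^ 2 * v 5 * u + v 1 * v 3 * v 5
  | 10 => -v 0 * v 2 ^ 2 * u + v 1 * v 3 ^ 2 - 2 * v 3 * v 4 ^ 2 * u - v 0 * v 1 * v 5 * u
  | 11 => -v 2 ^ 3 + v 0 * v 4 ^ 2 * u ^ 2 - v 0 * v 1 * v 3 * u - 3 * v 1 * v 2 * v 5 +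
      2 * v 1 ^ 2 * v 4 * u
  | 12 => -v 0 ^ 2 * v 1 * u ^ 2 + v 2 * v 4 ^ 2 * u - 2 * v 4 * v 5 ^ 2 - v 1 * v 2 * v 3
  | 13 => v 3 * v 4 * v 5
  | _ => 0

/-- The exponents of the lowest powers of `s` in `G_j (scaling s v)`. -/
def sexticOrder : ℕ → ℕ
  | 0 => 22
  | 1 => 10
  | 2 => 11
  | 3 => 12
  | 4 => 0
  | 5 => 1
  | 6 => 2
  | 7 => 3
  | 8 => 4
  | 9 => 5
  | 10 => 6
  | 11 => 7
  | 12 => 8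
  | _ => 0

/-- The quadratic expressions in the normalized cubic forms giving the normalized sextic forms. -/
def sexticOfCubic (u : ℂ) (d : ℕ → ℂ) : ℕ → ℂ
  | 0 => d 0 ^ 2 * u ^ 2 + d 13 ^ 2
  | 1 => -d 7 ^ 2 + 2 * d 0 * d 1 * u ^ 2 + 10 * d 13 * d 1 * u + 2 * d 2 * d 12
      - 2 * d 3 * d 11 - 4 * d 4 * d 10 - 2 * d 9 * d 5
  | 2 => -2 * d 1 ^ 2 * u - 4 * d 0 * d 2 * u + 6 * d 13 * d 2 - 2 * d 4 * d 11
      + 2 * d 5 * d 10 - 2 * d 6 * d 9 - 2 * d 7 * d 8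
  | 3 => -d 8 ^ 2 + 2 * d 0 * d 3 * u + 10 * d 13 * d 3 + 2 * d 6 * d 10 - 2 * d 9 * d 7
      - 4 * d 12 * d 4 - 2 * d 1 * d 2
  | 4 => -d 2 ^ 2 + 10 * d 0 * d 4 * u ^ 2 - 2 * d 13 * d 4 * u + 2 * d 5 * d 12 * u
      - 2 * d 9 * d 8 * u - 4 * d 1 * d 3 * u - 2 * d 10 * d 7 * u
  | 5 => -2 * d 9 ^ 2 * u - 4 * d 0 * d 5 * u ^ 2 + 6 * d 13 * d 5 * u
      - 2 * d 10 * d 8 * u + 2 * d 6 * d 12 * u - 2 * d 2 * d 3 - 2 * d 11 * d 7 * u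
  | 6 => -2 * d 3 ^ 2 - 4 * d 0 * d 6 * u ^ 2 + 6 * d 13 * d 6 * u - 2 * d 12 * d 7 * u
      + 2 * d 2 * d 4 - 2 * d 5 * d 1 * u - 2 * d 8 * d 11 * u
  | 7 => -2 * d 10 ^ 2 * u + 6 * d 0 * d 7 * u ^ 2 + 4 * d 13 * d 7 * u
      - 2 * d 1 * d 6 * u - 2 * d 2 * d 5 - 2 * d 8 * d 12 * u - 2 * d 9 * d 11 * u
  | 8 => -2 * d 4 ^ 2 + 6 * d 0 * d 8 * u ^ 2 + 4 * d 13 * d 8 * u - 2 * d 3 * d 5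
      - 2 * d 6 * d 2 - 2 * d 11 * d 10 * u - 2 * d 1 * d 7 * u
  | 9 => -d 11 ^ 2 * u + 2 * d 0 * d 9 * u ^ 2 + 10 * d 13 * d 9 * u + 2 * d 5 * d 4
      - 2 * d 1 * d 8 * u - 4 * d 10 * d 12 * u - 2 * d 3 * d 6
  | 10 => -d 5 ^ 2 + 10 * d 0 * d 10 * u ^ 2 - 2 * d 13 * d 10 * u + 2 * d 6 * d 4
      - 2 * d 3 * d 7 - 4 * d 9 * d 1 * u - 2 * d 12 * d 11 * u
  | 11 => -2 * d 12 ^ 2 * u + 6 * d 0 * d 11 * u ^ 2 + 4 * d 13 * d 11 * u - 2 * d 9 * d 2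
      - 2 * d 5 * d 6 - 2 * d 7 * d 4 - 2 * d 3 * d 8
  | 12 => -d 6 ^ 2 + 10 * d 0 * d 12 * u ^ 2 - 2 * d 13 * d 12 * u + 2 * d 2 * d 10
      - 2 * d 1 * d 11 * u - 4 * d 3 * d 9 - 2 * d 4 * d 8
  | _ => 0

/-- The sextic forms after scaling, divided by the lowest power of `s`, as functions of
`u = s ^ 13`. -/
def sexticNormalized (u : ℂ) (v : Fin 6 → ℂ) (j : ℕ) : ℂ :=
  sexticOfCubic u (cubicNormalized u v) j

lemma D_scaling (s : ℂ) (v : Fin 6 → ℂ) (j : ℕ) (hj : j < 13) :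
    D j (scaling s v) = s ^ cubicOrder j * cubicNormalized (s ^ 13) v j := by
  interval_cases j <;> simp [D, scaling, cubicOrder, cubicNormalized] <;> ring

lemma Dinf_scaling (s : ℂ) (v : Fin 6 → ℂ) :
    Dinf (scaling s v) = s ^ cubicOrder 13 * cubicNormalized (s ^ 13) v 13 := by
  simp [Dinf, scaling, cubicOrder, cubicNormalized]; ring

lemma Gs_scaling (s : ℂ) (v : Fin 6 → ℂ) (j : ℕ) (hj : j < 13) :
    Gs j (scaling s v) = s ^ sexticOrder j * sexticNormalized (s ^ 13) v j := by
  have h (i : ℕ) (hi : i < 13) := D_scaling s v i hi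
  have h0 := h 0 (by norm_num)
  have h1 := h 1 (by norm_num)
  have h2 := h 2 (by norm_num)
  have h3 := h 3 (by norm_num)
  have h4 := h 4 (by norm_num)
  have h5 := h 5 (by norm_num)
  have h6 := h 6 (by norm_num)
  have h7 := h 7 (by norm_num)
  have h8 := h 8 (by norm_num)
  have h9 := h 9 (by norm_num)
  have h10 := h 10 (by norm_num)
  have h11 := h 11 (by norm_num)
  have h12 := h 12 (by norm_num)
  have hinf := Dinf_scaling s v
  unfold sexticNormalized
  generalize cubicNormalized (s ^ 13) v = d at *
  interval_cases j <;>
  simp only [Gs, h0, h1, h2, h3, h4, h5, h6, h7, h8, h9, h10, h11, h12, hinf,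
    sexticOfCubic, sexticOrder, cubicOrder] <;> ring

lemma scaling_one (v : Fin 6 → ℂ) : scaling 1 v = v := by
  ext i; fin_cases i <;> simp [scaling]

lemma psi_eq_pow (x : ZMod 13) : ψ x = ζ ^ x.val := by
  have h := ZMod.stdAddChar_coe (N := 13) (x.val : ℤ)
  rw [Int.cast_natCast, ZMod.natCast_zmod_val] at h
  rw [h, zeta13, ← Complex.exp_nat_mul]
  congr 1
  push_cast
  ring

lemma psi_natCast (n : ℕ) : ψ (n : ZMod 13) = ζ ^ n := by
  have h := ZMod.stdAddChar_coe (N := 13) (n : ℤ)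
  rw [Int.cast_natCast] at h
  rw [h, zeta13, ← Complex.exp_nat_mul]
  congr 1
  push_cast
  ring

lemma psi_pow_thirteen (x : ZMod 13) : ψ x ^ 13 = 1 := by
  rw [← AddChar.map_nsmul_eq_pow]
  have : (13 : ℕ) • x = 0 := by
    rw [nsmul_eq_mul, show ((13 : ℕ) : ZMod 13) = 0 from rfl, zero_mul]
  rw [this, AddChar.map_zero_eq_one]

/-- The six coordinates of an odd function on `ZMod 13`, in the order of the theta constants. -/
def coords (v : ZMod 13 → ℂ) : Fin 6 → ℂ := ![v 1, v 3, v 9, v 8, v 11, v 7]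

/-- The unnormalized Fourier transform on `ZMod 13`. -/
def dft13 (v : ZMod 13 → ℂ) (x : ZMod 13) : ℂ := ∑ y, ψ (x * y) * v y

/-- Multiplication by the quadratic character `x ↦ ψ (μ x ^ 2)`. -/
def twist (μ : ZMod 13) (v : ZMod 13 → ℂ) (x : ZMod 13) : ℂ := ψ (μ * x ^ 2) * v x

lemma odd_dft13 {v : ZMod 13 → ℂ} (hv : v.Odd) : (dft13 v).Odd := by
  intro x
  unfold dft13
  rw [← Finset.sum_neg_distrib, ← Equiv.sum_comp (Equiv.neg (ZMod 13))]
  refine Finset.sum_congr rfl fun y _ => ?_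
  simp only [Equiv.neg_apply, hv y, mul_neg, neg_mul, neg_neg]

lemma odd_twist {v : ZMod 13 → ℂ} (hv : v.Odd) (μ : ZMod 13) : (twist μ v).Odd := by
  intro x
  simp only [twist, hv x, neg_sq, mul_neg]

lemma D_smul (c : ℂ) (v : Fin 6 → ℂ) (j : ℕ) : D j (c • v) = c ^ 3 * D j v := by
  rcases lt_or_ge j 13 with hj | hj
  · interval_cases j <;> simp only [D, Pi.smul_apply, smul_eq_mul] <;> ring
  · obtain ⟨k, rfl⟩ := Nat.exists_eq_add_of_le' hj
    simp [D]

lemma Dinf_smul (c : ℂ) (v : Fin 6 → ℂ) : Dinf (c • v) = c ^ 3 * Dinf v := by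
  simp only [Dinf, Pi.smul_apply, smul_eq_mul]; ring

lemma Gs_smul (c : ℂ) (v : Fin 6 → ℂ) (j : ℕ) : Gs j (c • v) = c ^ 6 * Gs j v := by
  rcases lt_or_ge j 13 with hj | hj
  · interval_cases j <;> simp only [Gs, D_smul, Dinf_smul] <;> ring
  · obtain ⟨k, rfl⟩ := Nat.exists_eq_add_of_le' hj
    simp [Gs]

lemma coords_smul (c : ℂ) (v : ZMod 13 → ℂ) : coords (c • v) = c • coords v := by
  ext i; fin_cases i <;> simp [coords]

lemma Gs_scaling_of_pow_eq_one {t : ℂ} (ht : t ^ 13 = 1) (v : Fin 6 → ℂ) (j : ℕ) (hj : j < 13) :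
    Gs j (scaling t v) = t ^ sexticOrder j * Gs j v := by
  have h1 := Gs_scaling 1 v j hj
  rw [scaling_one, one_pow, one_pow, one_mul] at h1
  rw [Gs_scaling t v j hj, ht, h1]

lemma scaling_coords (ν : ZMod 13) (v : ZMod 13 → ℂ) :
    scaling (ψ ν) (coords v) = ψ ν ^ 8 • coords (twist (7 * ν) v) := by
  have h (n : ℕ) (x : ZMod 13) (hx : 7 * x ^ 2 = n) : ψ (7 * ν * x ^ 2) = ψ ν ^ n := by
    rw [← AddChar.map_nsmul_eq_pow, nsmul_eq_mul, ← hx]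
    ring_nf
  have h13 := psi_pow_thirteen ν
  have h1 := h 7 1 rfl
  have h2 := h 11 3 rfl
  have h3 := h 8 9 rfl
  have h4 := h 6 8 rfl
  have h5 := h 2 11 rfl
  have h6 := h 5 7 rfl
  ext i
  fin_cases i <;>
  simp only [scaling, coords, twist, h1, h2, h3, h4, h5, h6, Pi.smul_apply, smul_eq_mul] <;>
  simp <;> generalize ψ ν = t at *
  · ring
  · linear_combination (-t ^ 6 * v 3) * h13
  · linear_combination (-t ^ 3 * v 9) * h13
  · linear_combination (-t * v 8) * h13
  · ring
  · linear_combination (-v 7) * h13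

lemma Gs_twist (ν : ZMod 13) (v : ZMod 13 → ℂ) (j : ℕ) (hj : j < 13) :
    Gs j (coords (twist (7 * ν) v)) = ψ ν ^ j * Gs j (coords v) := by
  have h13 := psi_pow_thirteen ν
  have h := Gs_scaling_of_pow_eq_one h13 (coords v) j hj
  rw [scaling_coords, Gs_smul] at h
  generalize ψ ν = t at *
  have h52 : t ^ 52 = 1 := by rw [show 52 = 13 * 4 from rfl, pow_mul, h13, one_pow]
  have key : t ^ 4 * t ^ sexticOrder j = t ^ j := by
    interval_cases j <;> simp only [sexticOrder]
    · linear_combination (t ^ 13 + 1) * h13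
    · linear_combination t * h13
    · linear_combination t ^ 2 * h13
    · linear_combination t ^ 3 * h13
    all_goals ring
  rw [← key]
  linear_combination t ^ 4 * h - Gs j (coords (twist (7 * ν) v)) * h52

lemma deltaF_zero_twist (ν : ZMod 13) (v : ZMod 13 → ℂ) :
    deltaF 0 (coords (twist (7 * ν) v)) = deltaF ν.val (coords v) := by
  unfold deltaF
  rw [Gs_twist ν v 0 (by norm_num), pow_zero, one_mul]
  congr 1
  refine Finset.sum_congr rfl fun j hj => ?_
  rw [Gs_twist ν v j (by rw [Finset.mem_Icc] at hj; omega), psi_eq_pow, ← pow_mul, mul_comm ν.val,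
    mul_zero, pow_zero, one_mul]

lemma Gs_zero_twist (μ : ZMod 13) (v : ZMod 13 → ℂ) :
    Gs 0 (coords (twist μ v)) = Gs 0 (coords v) := by
  have h := Gs_twist (2 * μ) v 0 (by norm_num)
  rwa [pow_zero, one_mul, ← mul_assoc, show (7 * 2 : ZMod 13) = 1 from rfl, one_mul] at h

lemma Gs_zero_coords (v : ZMod 13 → ℂ) :
    Gs 0 (coords v) = (v 1 * v 3 * v 9) ^ 2 + (v 8 * v 11 * v 7) ^ 2 := rfl

lemma Gs_zero_dilate {v : ZMod 13 → ℂ} (hv : v.Odd) {k : ZMod 13} (hk : k ≠ 0) :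
    Gs 0 (coords fun x => v (k * x)) = Gs 0 (coords v) := by
  have h2 (w : ZMod 13 → ℂ) (hw : w.Odd) :
      Gs 0 (coords fun x => w (2 * x)) = Gs 0 (coords w) := by
    have e1 : w 2 = -w 11 := hw 11
    have e2 : w 6 = -w 7 := hw 7
    have e3 : w 5 = -w 8 := hw 8
    rw [Gs_zero_coords, Gs_zero_coords]
    change (w 2 * w 6 * w 5) ^ 2 + (w 3 * w 9 * w 1) ^ 2 = _
    rw [e1, e2, e3]
    ring
  have hpow (n : ℕ) : Gs 0 (coords fun x => v (2 ^ n * x)) = Gs 0 (coords v) := by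
    induction n with
    | zero => simp
    | succ n ih =>
      rw [← ih, ← h2 (fun x => v (2 ^ n * x)) fun x => by simp only [mul_neg, hv _]]
      simp only [pow_succ, mul_assoc]
  obtain ⟨n, rfl⟩ : ∃ n : ℕ, k = 2 ^ n := by
    have : ∀ k : ZMod 13, k ≠ 0 → ∃ n : Fin 12, k = 2 ^ (n : ℕ) := by decide
    obtain ⟨n, hn⟩ := this k hk
    exact ⟨n, hn⟩
  exact hpow n

lemma sum_psi_mul (a : ZMod 13) : ∑ y, ψ (y * a) = if a = 0 then 13 else 0 := by
  have h := AddChar.sum_mulShift a (ZMod.isPrimitive_stdAddChar 13)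
  simpa [AddChar.mulShift_apply] using h

lemma dft13_dft13 {v : ZMod 13 → ℂ} (hv : v.Odd) : dft13 (dft13 v) = (-13 : ℂ) • v := by
  ext x
  simp only [dft13, Finset.mul_sum]
  rw [Finset.sum_comm]
  have h (u : ZMod 13) : ∑ y, ψ (x * y) * (ψ (y * u) * v u) =
      if u = -x then 13 * v u else 0 := by
    have : ∑ y, ψ (x * y) * (ψ (y * u) * v u) = (∑ y, ψ (y * (u + x))) * v u := by
      rw [Finset.sum_mul]
      refine Finset.sum_congr rfl fun y _ => ?_
      rw [mul_add, AddChar.map_add_eq_mul, mul_comm x y]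
      ring
    rw [this, sum_psi_mul]
    simp only [← eq_neg_iff_add_eq_zero]
    split_ifs <;> simp
  simp only [h, Finset.sum_ite_eq', Finset.mem_univ, if_true, hv x]
  simp

/-- The quadratic Gauss sum modulo `13` with parameter `μ`. -/
def gaussSq (μ : ZMod 13) : ℂ := ∑ y, ψ (μ * y ^ 2)

lemma gaussSq_sq {μ : ZMod 13} (hμ : μ ≠ 0) : gaussSq μ ^ 2 = 13 := by
  have : Fact (Nat.Prime 13) := ⟨by norm_num⟩
  have h13 : (13 : ZMod 13) = 0 := rfl
  let e : ZMod 13 × ZMod 13 ≃ ZMod 13 × ZMod 13 :=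
    { toFun p := (p.1 - 5 * p.2, p.1 + 5 * p.2)
      invFun p := (7 * (p.1 + p.2), 4 * (p.2 - p.1))
      left_inv p := by
        ext
        · linear_combination p.1 * h13
        · linear_combination 3 * p.2 * h13
      right_inv p := by
        ext
        · linear_combination (2 * p.1 - p.2) * h13
        · linear_combination (-p.1 + 2 * p.2) * h13 }
  have h1 : gaussSq μ ^ 2 = ∑ p : ZMod 13 × ZMod 13, ψ (μ * ((p.1 - 5 * p.2) * (p.1 + 5 * p.2))) := by
    rw [sq, gaussSq, Finset.sum_mul_sum, ← Finset.sum_product', Finset.univ_product_univ]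
    refine Finset.sum_congr rfl fun p _ => ?_
    rw [← AddChar.map_add_eq_mul]
    congr 1
    linear_combination 2 * μ * p.2 ^ 2 * h13
  have h2 := e.sum_comp fun p : ZMod 13 × ZMod 13 => ψ (μ * (p.1 * p.2))
  rw [h1, show ∑ p : ZMod 13 × ZMod 13, ψ (μ * ((p.1 - 5 * p.2) * (p.1 + 5 * p.2))) = _ from h2,
    ← Finset.univ_product_univ, Finset.sum_product]
  have h3 (x : ZMod 13) : ∑ y, ψ (μ * (x * y)) = if x = 0 then 13 else 0 := by
    have := sum_psi_mul (μ * x)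
    simp only [mul_eq_zero, hμ, false_or] at this
    rw [← this]
    exact Finset.sum_congr rfl fun y _ => by congr 1; ring
  simp [h3]

lemma dft13_twist_dft13 (v : ZMod 13 → ℂ) {μ κ : ZMod 13} (h : 4 * μ * κ = -1) :
    dft13 (twist μ (dft13 v)) =
      gaussSq μ • twist κ fun x => dft13 (twist κ v) (2 * κ * x) := by
  ext x
  have hc (u : ZMod 13) :
      ∑ y, ψ (x * y) * (ψ (μ * y ^ 2) * ψ (y * u)) = gaussSq μ * ψ (κ * (x + u) ^ 2) := by
    rw [gaussSq, Finset.sum_mul, ← Equiv.sum_comp (Equiv.addRight (-2 * κ * (x + u)))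
      fun y => ψ (μ * y ^ 2) * ψ (κ * (x + u) ^ 2)]
    refine Finset.sum_congr rfl fun y _ => ?_
    simp only [Equiv.coe_addRight, ← AddChar.map_add_eq_mul]
    congr 1
    linear_combination (y * (x + u) - κ * (x + u) ^ 2) * h
  simp only [dft13, twist, Finset.mul_sum, Pi.smul_apply, smul_eq_mul]
  rw [Finset.sum_comm]
  refine Finset.sum_congr rfl fun u _ => ?_
  have : ∑ y, ψ (x * y) * (ψ (μ * y ^ 2) * (ψ (y * u) * v u)) =
      (∑ y, ψ (x * y) * (ψ (μ * y ^ 2) * ψ (y * u))) * v u := by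
    rw [Finset.sum_mul]
    exact Finset.sum_congr rfl fun y _ => by ring
  rw [this, hc, show κ * (x + u) ^ 2 = κ * x ^ 2 + (2 * κ * x * u + κ * u ^ 2) by ring,
    AddChar.map_add_eq_mul, AddChar.map_add_eq_mul]
  ring

/-- The transformation of the cubic form `D_0` under the odd Fourier matrix. -/
lemma cubic_fourier_identity {t α β γ α' β' γ' a b : ℂ} (v : Fin 6 → ℂ)
    (ht : 1 + t + t ^ 2 + t ^ 3 + t ^ 4 + t ^ 5 + t ^ 6 + t ^ 7 + t ^ 8 + t ^ 9 + t ^ 10 + t ^ 11 +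
      t ^ 12 = 0)
    (hα : α = t - t ^ 12) (hβ : β = t ^ 3 - t ^ 10) (hγ : γ = t ^ 9 - t ^ 4)
    (hα' : α' = t ^ 8 - t ^ 5) (hβ' : β' = t ^ 11 - t ^ 2) (hγ' : γ' = t ^ 7 - t ^ 6)
    (ha : a = α + β + γ) (hb : b = -(α' + β' + γ')) :
    (α * v 0 + β * v 1 + γ * v 2 + α' * v 3 + β' * v 4 + γ' * v 5) *
    (β * v 0 + γ * v 1 + α * v 2 + β' * v 3 + γ' * v 4 + α' * v 5) *
    (γ * v 0 + α * v 1 + β * v 2 + γ' * v 3 + α' * v 4 + β' * v 5) =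
      (-2 * a + 3 * b) * D 0 v + (3 * a + 2 * b) * Dinf v - (a + b) * (D 1 v + D 3 v + D 9 v)
        - a * (D 2 v + D 5 v + D 6 v) - b * (D 7 v + D 8 v + D 11 v)
        + (a - b) * (D 4 v + D 10 v + D 12 v) := by
  have r0 : α * β * γ = b := by
    subst ha hb hα hβ hγ hα' hβ' hγ'
    linear_combination (-t ^ 2 + t ^ 3 - t ^ 5 + 2 * t ^ 7 - t ^ 8 + t ^ 11 - t ^ 12 + t ^ 13
      - t ^ 14 - t ^ 18 + t ^ 19) * ht
  have r1 : α ^ 2 * β + α * γ ^ 2 + β ^ 2 * γ = -a + b := by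
    subst ha hb hα hβ hγ hα' hβ' hγ'
    linear_combination (t - 2 * t ^ 2 + 2 * t ^ 3 - 2 * t ^ 4 + t ^ 5 - t ^ 6 + 2 * t ^ 7 + t ^ 9
      - 4 * t ^ 10 + 3 * t ^ 11 - 3 * t ^ 12 + 2 * t ^ 13 - t ^ 14 + t ^ 15
      - t ^ 16 + 2 * t ^ 17 - t ^ 18 + t ^ 21 - t ^ 22) * ht
  have r2 : α ^ 2 * γ + α * β ^ 2 + β * γ ^ 2 = -2 * a - 2 * b := by
    subst ha hb hα hβ hγ hα' hβ' hγ'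
    linear_combination (2 * t - 4 * t ^ 4 + 4 * t ^ 5 - t ^ 6 - 2 * t ^ 7 - t ^ 8 + 4 * t ^ 9
      - 4 * t ^ 10 + 2 * t ^ 11 - 2 * t ^ 12 + 2 * t ^ 13 + 2 * t ^ 15 - 2 * t ^ 16
      + t ^ 19 - 2 * t ^ 20 + t ^ 21) * ht
  have r3 : α * β * γ' + α * γ * β' + β * γ * α' = -2 * b := by
    subst ha hb hα hβ hγ hα' hβ' hγ'
    linear_combination (2 * t ^ 2 - 2 * t ^ 3 + 2 * t ^ 5 - 3 * t ^ 7 - t ^ 8 + 2 * t ^ 9 - t ^ 10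
      + t ^ 12 + t ^ 15 - 2 * t ^ 16 + t ^ 17 + t ^ 19 - t ^ 20) * ht
  have r4 : α * β * α' + α * γ * γ' + β * γ * β' = -a - b := by
    subst ha hb hα hβ hγ hα' hβ' hγ'
    linear_combination (t - 2 * t ^ 4 + 2 * t ^ 5 - 2 * t ^ 7 + 2 * t ^ 9 - 2 * t ^ 10 + t ^ 11
      - t ^ 12 + t ^ 13 + t ^ 15 - t ^ 16) * ht
  have r5 : α * β * β' + α * γ * α' + β * γ * γ' = -a := by
    subst ha hb hα hβ hγ hα' hβ' hγ'
    linear_combination (t - t ^ 2 + t ^ 3 - 2 * t ^ 4 + t ^ 5 - t ^ 6 + t ^ 7 + t ^ 9 - t ^ 10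
      - t ^ 12 + 2 * t ^ 13 - t ^ 14 + t ^ 16 - t ^ 17 - t ^ 20 + t ^ 21) * ht
  have r6 : α ^ 3 + 3 * α * β * γ + β ^ 3 + γ ^ 3 = -2 * a + 3 * b := by
    subst ha hb hα hβ hγ hα' hβ' hγ'
    linear_combination (2 * t - 5 * t ^ 2 + 6 * t ^ 3 - 5 * t ^ 4 - t ^ 5 + 6 * t ^ 7 - 3 * t ^ 8
      + 3 * t ^ 9 - 5 * t ^ 10 + 5 * t ^ 11 - 6 * t ^ 12 + 6 * t ^ 13 - 4 * t ^ 14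
      + t ^ 15 + t ^ 17 - 4 * t ^ 18 + 3 * t ^ 19 + t ^ 23 - t ^ 24) * ht
  have r7 : α ^ 2 * β' + α * β * α' + α * γ * γ' + β ^ 2 * γ' + β * γ * β' + γ ^ 2 * α' = b := by
    subst ha hb hα hβ hγ hα' hβ' hγ'
    linear_combination (-t ^ 2 + t ^ 3 - t ^ 4 + 2 * t ^ 7 - t ^ 9 + 2 * t ^ 11 - 3 * t ^ 12
      + 2 * t ^ 13 - 2 * t ^ 14 + 2 * t ^ 15 - t ^ 16 - t ^ 22 + t ^ 23) * ht
  have r8 : α ^ 2 * γ' + α * β * β' + α * γ * α' + β ^ 2 * α' + β * γ * γ' + γ ^ 2 * β' = 3 * b := by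
    subst ha hb hα hβ hγ hα' hβ' hγ'
    linear_combination (-3 * t ^ 2 + 3 * t ^ 3 - 3 * t ^ 5 - t ^ 6 + 7 * t ^ 7 - t ^ 8 - t ^ 9
      - t ^ 10 + 2 * t ^ 11 - 2 * t ^ 12 + t ^ 13 - t ^ 14 - t ^ 15 + t ^ 16
      + t ^ 17 - 2 * t ^ 18 + t ^ 19 - t ^ 20 + t ^ 21) * ht
  have r9 : α ^ 2 * α' + α * β * γ' + α * γ * β' + β ^ 2 * β' + β * γ * α' + γ ^ 2 * γ' = -a + b := by
    subst ha hb hα hβ hγ hα' hβ' hγ'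
    linear_combination (t - 2 * t ^ 2 + 2 * t ^ 3 - 2 * t ^ 4 + 2 * t ^ 7 - t ^ 8 + t ^ 9
      - 2 * t ^ 10 + 3 * t ^ 11 - 3 * t ^ 12 + t ^ 13 + t ^ 15 - t ^ 16 - t ^ 18
      + t ^ 19) * ht
  have r10 : α * β' * γ' + β * α' * γ' + γ * α' * β' = 2 * a := by
    subst ha hb hα hβ hγ hα' hβ' hγ'
    linear_combination (-2 * t + 2 * t ^ 2 - 2 * t ^ 3 + 4 * t ^ 4 - 2 * t ^ 5 - t ^ 9 + 2 * t ^ 10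
      - 2 * t ^ 11 + 3 * t ^ 12 - 2 * t ^ 13 - t ^ 15 + 2 * t ^ 17 - t ^ 18) * ht
  have r11 : α * α' * β' + α * γ' ^ 2 + β * α' ^ 2 + β * β' * γ' + γ * α' * γ' + γ * β' ^ 2 = -a := by
    subst ha hb hα hβ hγ hα' hβ' hγ'
    linear_combination (t - t ^ 2 + t ^ 3 - 2 * t ^ 4 + t ^ 5 + t ^ 9 - 2 * t ^ 10 + t ^ 11
      - 2 * t ^ 12 + 5 * t ^ 13 - 4 * t ^ 14 + t ^ 15) * ht
  have r12 : α * α' * γ' + α * β' ^ 2 + β * α' * β' + β * γ' ^ 2 + γ * α' ^ 2 + γ * β' * γ' = -3 * a := by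
    subst ha hb hα hβ hγ hα' hβ' hγ'
    linear_combination (3 * t - 3 * t ^ 2 + 3 * t ^ 3 - 6 * t ^ 4 + 4 * t ^ 5 - t ^ 6 + 3 * t ^ 9
      - 5 * t ^ 10 + 2 * t ^ 11 - 3 * t ^ 12 + 2 * t ^ 13 + t ^ 14 + t ^ 16
      - t ^ 17 + t ^ 21 - t ^ 22) * ht
  have r13 : α * α' * γ' + β * α' * β' + γ * β' * γ' = -b := by
    subst ha hb hα hβ hγ hα' hβ' hγ'
    linear_combination (t ^ 2 - t ^ 3 + t ^ 5 - 2 * t ^ 7 + t ^ 9 + t ^ 10 - 2 * t ^ 11 + t ^ 12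
      - t ^ 13 + t ^ 14 + t ^ 16 - t ^ 17) * ht
  have r14 : α * α' ^ 2 + α * β' * γ' + β * α' * γ' + β * β' ^ 2 + γ * α' * β' + γ * γ' ^ 2 = -a - b := by
    subst ha hb hα hβ hγ hα' hβ' hγ'
    linear_combination (t - 2 * t ^ 4 + 2 * t ^ 5 - t ^ 7 - t ^ 8 + 3 * t ^ 9 - 4 * t ^ 10 + t ^ 11
      + t ^ 13 - t ^ 16 + 2 * t ^ 17 - t ^ 18 + t ^ 19 - t ^ 20) * ht
  have r15 : α * α' * β' + β * β' * γ' + γ * α' * γ' = a - b := by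
    subst ha hb hα hβ hγ hα' hβ' hγ'
    linear_combination (-t + 2 * t ^ 2 - 2 * t ^ 3 + 2 * t ^ 4 - 2 * t ^ 7 + t ^ 8 - t ^ 9
      + 2 * t ^ 10 - 2 * t ^ 11 + t ^ 12 - t ^ 14 + t ^ 15 + t ^ 18 - t ^ 19) * ht
  have r16 : α' * β' * γ' = a := by
    subst ha hb hα hβ hγ hα' hβ' hγ'
    linear_combination (-t + t ^ 2 - t ^ 3 + 2 * t ^ 4 - t ^ 5 - t ^ 9 + 2 * t ^ 10 - t ^ 11 + t ^ 12
      - 2 * t ^ 13 + t ^ 14) * ht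
  have r17 : α' ^ 2 * β' + α' * γ' ^ 2 + β' ^ 2 * γ' = a + b := by
    subst ha hb hα hβ hγ hα' hβ' hγ'
    linear_combination (-t + 2 * t ^ 4 - 2 * t ^ 5 + 2 * t ^ 7 - 2 * t ^ 9 + t ^ 10 + 2 * t ^ 11
      - 2 * t ^ 12 - t ^ 14 + 2 * t ^ 15 - 2 * t ^ 16 + t ^ 17) * ht
  have r18 : α' ^ 2 * γ' + α' * β' ^ 2 + β' * γ' ^ 2 = -2 * a + 2 * b := by
    subst ha hb hα hβ hγ hα' hβ' hγ'
    linear_combination (2 * t - 4 * t ^ 2 + 4 * t ^ 3 - 4 * t ^ 4 + 4 * t ^ 7 - t ^ 9 - 3 * t ^ 10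
      + 4 * t ^ 11 - 3 * t ^ 12 + t ^ 13 + t ^ 14 - t ^ 15 - t ^ 17 + t ^ 18) * ht
  have r19 : α' ^ 3 + 3 * α' * β' * γ' + β' ^ 3 + γ' ^ 3 = 3 * a + 2 * b := by
    subst ha hb hα hβ hγ hα' hβ' hγ'
    linear_combination (-3 * t + t ^ 2 - t ^ 3 + 6 * t ^ 4 - 5 * t ^ 5 - t ^ 6 + 5 * t ^ 7
      - 5 * t ^ 9 + 6 * t ^ 10 - t ^ 11 + t ^ 12 - 6 * t ^ 13 + 3 * t ^ 14 - t ^ 20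
      + t ^ 21) * ht
  simp only [D, Dinf]
  linear_combination (v 0 ^ 3 + v 1 ^ 3 + v 2 ^ 3) * r0
    + (v 0 ^ 2 * v 1 + v 0 * v 2 ^ 2 + v 1 ^ 2 * v 2) * r1
    + (v 0 ^ 2 * v 2 + v 0 * v 1 ^ 2 + v 1 * v 2 ^ 2) * r2
    + (v 0 ^ 2 * v 3 + v 1 ^ 2 * v 4 + v 2 ^ 2 * v 5) * r3
    + (v 0 ^ 2 * v 4 + v 1 ^ 2 * v 5 + v 2 ^ 2 * v 3) * r4
    + (v 0 ^ 2 * v 5 + v 1 ^ 2 * v 3 + v 2 ^ 2 * v 4) * r5 + (v 0 * v 1 * v 2) * r6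
    + (v 0 * v 1 * v 3 + v 0 * v 2 * v 5 + v 1 * v 2 * v 4) * r7
    + (v 0 * v 1 * v 4 + v 0 * v 2 * v 3 + v 1 * v 2 * v 5) * r8
    + (v 0 * v 1 * v 5 + v 0 * v 2 * v 4 + v 1 * v 2 * v 3) * r9
    + (v 0 * v 3 ^ 2 + v 1 * v 4 ^ 2 + v 2 * v 5 ^ 2) * r10
    + (v 0 * v 3 * v 4 + v 1 * v 4 * v 5 + v 2 * v 3 * v 5) * r11
    + (v 0 * v 3 * v 5 + v 1 * v 3 * v 4 + v 2 * v 4 * v 5) * r12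
    + (v 0 * v 4 ^ 2 + v 1 * v 5 ^ 2 + v 2 * v 3 ^ 2) * r13
    + (v 0 * v 4 * v 5 + v 1 * v 3 * v 5 + v 2 * v 3 * v 4) * r14
    + (v 0 * v 5 ^ 2 + v 1 * v 3 ^ 2 + v 2 * v 4 ^ 2) * r15 + (v 3 ^ 3 + v 4 ^ 3 + v 5 ^ 3) * r16
    + (v 3 ^ 2 * v 4 + v 3 * v 5 ^ 2 + v 4 ^ 2 * v 5) * r17
    + (v 3 ^ 2 * v 5 + v 3 * v 4 ^ 2 + v 4 * v 5 ^ 2) * r18 + (v 3 * v 4 * v 5) * r19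

lemma zeta13_isPrimitiveRoot : IsPrimitiveRoot zeta13 13 := by
  have h := Complex.isPrimitiveRoot_exp 13 (by norm_num)
  rwa [show (2 * Real.pi * Complex.I / (13 : ℕ) : ℂ) = 2 * Real.pi * Complex.I / 13 by push_cast; rfl]
    at h

lemma geom_sum_thirteen {t : ℂ} (ht : IsPrimitiveRoot t 13) :
    1 + t + t ^ 2 + t ^ 3 + t ^ 4 + t ^ 5 + t ^ 6 + t ^ 7 + t ^ 8 + t ^ 9 + t ^ 10 + t ^ 11 +
      t ^ 12 = 0 := by
  rw [← ht.geom_sum_eq_zero (by norm_num)]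
  simp [Finset.sum_range_succ]

lemma dft13_apply_odd {v : ZMod 13 → ℂ} (hv : v.Odd) (x : ZMod 13) :
    dft13 v x = (ψ x - ψ (12 * x)) * v 1 + (ψ (3 * x) - ψ (10 * x)) * v 3 +
      (ψ (9 * x) - ψ (4 * x)) * v 9 + (ψ (8 * x) - ψ (5 * x)) * v 8 +
      (ψ (11 * x) - ψ (2 * x)) * v 11 + (ψ (7 * x) - ψ (6 * x)) * v 7 := by
  have e0 : v 0 = 0 := by
    have h : v 0 = -v 0 := by simpa using hv 0
    linear_combination (1 / 2) * h
  have e1 : v 12 = -v 1 := hv 1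
  have e2 : v 10 = -v 3 := hv 3
  have e3 : v 4 = -v 9 := hv 9
  have e4 : v 5 = -v 8 := hv 8
  have e5 : v 2 = -v 11 := hv 11
  have e6 : v 6 = -v 7 := hv 7
  have h : dft13 v x = ψ (x * 0) * v 0 + ψ (x * 1) * v 1 + ψ (x * 2) * v 2 + ψ (x * 3) * v 3 +
      ψ (x * 4) * v 4 + ψ (x * 5) * v 5 + ψ (x * 6) * v 6 + ψ (x * 7) * v 7 + ψ (x * 8) * v 8 +
      ψ (x * 9) * v 9 + ψ (x * 10) * v 10 + ψ (x * 11) * v 11 + ψ (x * 12) * v 12 := by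
    unfold dft13
    change ∑ y : Fin 13, _ = _
    simp only [Fin.sum_univ_castSucc, Fin.sum_univ_zero, zero_add]
    rfl
  rw [h, e0, e1, e2, e3, e4, e5, e6, mul_one]
  simp only [mul_comm x]
  ring

lemma Gs_zero_dft13 {v : ZMod 13 → ℂ} (hv : v.Odd) :
    Gs 0 (coords (dft13 v)) = 13 * deltaF 0 (coords v) := by
  have hp (x : ZMod 13) (n : ℕ) (h : x = n) : ψ x = ζ ^ n := by rw [h, psi_natCast]
  have c1 := hp 1 1 rfl
  have c2 := hp 2 2 rfl
  have c3 := hp 3 3 rfl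
  have c4 := hp 4 4 rfl
  have c5 := hp 5 5 rfl
  have c6 := hp 6 6 rfl
  have c7 := hp 7 7 rfl
  have c8 := hp 8 8 rfl
  have c9 := hp 9 9 rfl
  have c10 := hp 10 10 rfl
  have c11 := hp 11 11 rfl
  have c12 := hp 12 12 rfl
  have coord (x c3 c4 c5 c6 c7 c8 c9 c10 c11 c12 c2 : ZMod 13) (h2 : 2 * x = c2) (h3 : 3 * x = c3)
      (h4 : 4 * x = c4) (h5 : 5 * x = c5) (h6 : 6 * x = c6) (h7 : 7 * x = c7) (h8 : 8 * x = c8)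
      (h9 : 9 * x = c9) (h10 : 10 * x = c10) (h11 : 11 * x = c11) (h12 : 12 * x = c12) :
      dft13 v x = (ψ x - ψ c12) * v 1 + (ψ c3 - ψ c10) * v 3 +
      (ψ c9 - ψ c4) * v 9 + (ψ c8 - ψ c5) * v 8 +
      (ψ c11 - ψ c2) * v 11 + (ψ c7 - ψ c6) * v 7 := by
    rw [dft13_apply_odd hv, h2, h3, h4, h5, h6, h7, h8, h9, h10, h11, h12]
  have f1 := coord 1 3 4 5 6 7 8 9 10 11 12 2 rfl rfl rfl rfl rfl rfl rfl rfl rfl rfl rfl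
  have f3 := coord 3 9 12 2 5 8 11 1 4 7 10 6 rfl rfl rfl rfl rfl rfl rfl rfl rfl rfl rfl
  have f9 := coord 9 1 10 6 2 11 7 3 12 8 4 5 rfl rfl rfl rfl rfl rfl rfl rfl rfl rfl rfl
  have f8 := coord 8 11 6 1 9 4 12 7 2 10 5 3 rfl rfl rfl rfl rfl rfl rfl rfl rfl rfl rfl
  have f11 := coord 11 7 5 3 1 12 10 8 6 4 2 9 rfl rfl rfl rfl rfl rfl rfl rfl rfl rfl rfl
  have f7 := coord 7 8 2 9 3 10 4 11 5 12 6 1 rfl rfl rfl rfl rfl rfl rfl rfl rfl rfl rfl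
  rw [c1, c2, c3, c4, c5, c6, c7, c8, c9, c10, c11, c12, pow_one] at f1 f3 f9 f8 f11 f7
  have ht := geom_sum_thirteen zeta13_isPrimitiveRoot
  have ht' := geom_sum_thirteen (zeta13_isPrimitiveRoot.pow_of_coprime 8 (by norm_num))
  have h13 := zeta13_isPrimitiveRoot.pow_eq_one
  generalize zeta13 = t at *
  have k0 := cubic_fourier_identity (coords v) ht rfl rfl rfl rfl rfl rfl rfl rfl
  have k1 := cubic_fourier_identity (coords v) ht' rfl rfl rfl rfl rfl rfl rfl rfl
  have red (m n r : ℕ) (h : n = 13 * m + r) : t ^ n = t ^ r := by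
    rw [h, pow_add, pow_mul, h13, one_pow, one_mul]
  simp only [← pow_mul, Nat.reduceMul] at k1
  rw [red 1 16 3 rfl, red 1 24 11 rfl, red 2 32 6 rfl, red 3 40 1 rfl, red 3 48 9 rfl,
    red 4 56 4 rfl, red 4 64 12 rfl, red 5 72 7 rfl, red 6 80 2 rfl, red 6 88 10 rfl,
    red 7 96 5 rfl, pow_one] at k1
  have hab : (t - t ^ 12 + (t ^ 3 - t ^ 10) + (t ^ 9 - t ^ 4)) ^ 2 +
      (t ^ 8 - t ^ 5 + (t ^ 11 - t ^ 2) + (t ^ 7 - t ^ 6)) ^ 2 = -13 := by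
    linear_combination (13 - 13 * t + t ^ 2 - t ^ 3 + 3 * t ^ 4 - 5 * t ^ 5 + 3 * t ^ 6 - t ^ 7 + 3 * t ^ 8
      - 5 * t ^ 9 + 3 * t ^ 10 - t ^ 11 + t ^ 12) * ht
  rw [Gs_zero_coords, f1, f3, f9, f8, f11, f7]
  refine (congrArg₂ (fun x y => x ^ 2 + y ^ 2) k0 k1).trans ?_
  generalize coords v = z
  simp only [deltaF, Finset.sum_Icc_succ_top, Nat.reduceLeDiff, Finset.Icc_self,
    Finset.sum_singleton, mul_zero, pow_zero, one_mul, Gs]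
  generalize D 0 z = d0
  generalize D 1 z = d1
  generalize D 2 z = d2
  generalize D 3 z = d3
  generalize D 4 z = d4
  generalize D 5 z = d5
  generalize D 6 z = d6
  generalize D 7 z = d7
  generalize D 8 z = d8
  generalize D 9 z = d9
  generalize D 10 z = d10
  generalize D 11 z = d11
  generalize D 12 z = d12
  generalize Dinf z = di
  generalize hα : t - t ^ 12 = α at *
  have hα2 : t ^ 12 - t = -α := by rw [← hα]; ring
  generalize hβ : t ^ 3 - t ^ 10 = β at *
  have hβ2 : t ^ 10 - t ^ 3 = -β := by rw [← hβ]; ring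
  generalize hγ : t ^ 9 - t ^ 4 = γ at *
  have hγ2 : t ^ 4 - t ^ 9 = -γ := by rw [← hγ]; ring
  generalize hα' : t ^ 8 - t ^ 5 = α' at *
  generalize hβ' : t ^ 11 - t ^ 2 = β' at *
  generalize hγ' : t ^ 7 - t ^ 6 = γ' at *
  rw [hα2, hβ2, hγ2]
  obtain ⟨a, ha⟩ : ∃ a, a = α + β + γ := ⟨_, rfl⟩
  obtain ⟨b, hb⟩ : ∃ b, b = -(α' + β' + γ') := ⟨_, rfl⟩
  rw [← hb, ← ha, show -(-α + -β + -γ) = a by rw [ha]; ring,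
    show α' + β' + γ' = -b by rw [hb]; ring]
  have hab' : a ^ 2 + b ^ 2 = -13 := by rw [← hab, ha, hb]; ring
  linear_combination ((-2 * d0 + 3 * di - (d1 + d3 + d9) - (d2 + d5 + d6) + (d4 + d10 + d12)) ^ 2 +
    (3 * d0 + 2 * di - (d1 + d3 + d9) - (d7 + d8 + d11) - (d4 + d10 + d12)) ^ 2) * hab'

lemma deltaInf_dft13 {v : ZMod 13 → ℂ} (hv : v.Odd) :
    deltaInf (coords (dft13 v)) = 13 ^ 3 * deltaF 0 (coords v) := by
  rw [deltaInf, Gs_zero_dft13 hv]; ring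

lemma deltaF_zero_dft13 {v : ZMod 13 → ℂ} (hv : v.Odd) :
    deltaF 0 (coords (dft13 v)) = 13 ^ 3 * deltaInf (coords v) := by
  have h := Gs_zero_dft13 (odd_dft13 hv)
  rw [dft13_dft13 hv, coords_smul, Gs_smul] at h
  rw [deltaInf]
  linear_combination (-1 / 13) * h

lemma deltaF_val_dft13 {v : ZMod 13 → ℂ} (hv : v.Odd) {ν : ZMod 13} (hν : ν ≠ 0) :
    deltaF ν.val (coords (dft13 v)) = 13 ^ 3 * deltaF (-ν⁻¹).val (coords v) := by
  have h13 : (13 : ZMod 13) = 0 := rfl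
  have n2 : (2 : ZMod 13) ≠ 0 := by decide
  have n7 : (7 : ZMod 13) ≠ 0 := by decide
  have : Fact (Nat.Prime 13) := ⟨by norm_num⟩
  have hμ : (7 * ν) ≠ 0 := mul_ne_zero n7 hν
  have hκ : (2 * (7 * -ν⁻¹)) ≠ 0 :=
    mul_ne_zero n2 (mul_ne_zero n7 (neg_ne_zero.mpr (inv_ne_zero hν)))
  have hμκ : 4 * (7 * ν) * (7 * -ν⁻¹) = -1 := by
    field_simp
    linear_combination (-15) * h13
  rw [← deltaF_zero_twist, ← deltaF_zero_twist]
  have h1 := Gs_zero_dft13 (odd_twist (odd_dft13 hv) (7 * ν))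
  have h2 := Gs_zero_dft13 (odd_twist hv (7 * -ν⁻¹))
  rw [dft13_twist_dft13 v hμκ, coords_smul, Gs_smul, Gs_zero_twist,
    Gs_zero_dilate (odd_dft13 (odd_twist hv _)) hκ, h2] at h1
  have hg : gaussSq (7 * ν) ^ 6 = 13 ^ 3 := by
    rw [← gaussSq_sq hμ]; ring
  rw [hg] at h1
  linear_combination (-1 / 13) * h1

lemma Phi30_dft13 {v : ZMod 13 → ℂ} (hv : v.Odd) :
    Phi30 (coords (dft13 v)) = 13 ^ 15 * Phi30 (coords v) := by
  have : Fact (Nat.Prime 13) := ⟨by norm_num⟩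
  have hsum (f : ℕ → ℂ) : ∑ ν ∈ Finset.range 13, f ν =
      f 0 + ∑ ν ∈ Finset.univ.erase (0 : ZMod 13), f ν.val := by
    rw [Finset.sum_range]
    exact (Finset.add_sum_erase _ (fun ν : ZMod 13 => f ν.val) (Finset.mem_univ 0)).symm
  rw [Phi30, Phi30, hsum, hsum, deltaF_zero_dft13 hv, deltaInf_dft13 hv]
  have key : ∑ ν ∈ Finset.univ.erase (0 : ZMod 13), deltaF ν.val (coords (dft13 v)) ^ 5 =
      13 ^ 15 * ∑ ν ∈ Finset.univ.erase (0 : ZMod 13), deltaF ν.val (coords v) ^ 5 := by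
    rw [Finset.mul_sum]
    refine Finset.sum_nbij' (fun ν => -ν⁻¹) (fun ν => -ν⁻¹) ?_ ?_ ?_ ?_ ?_
    · simp
    · simp
    · simp [inv_neg]
    · simp [inv_neg]
    · intro ν hν
      rw [deltaF_val_dft13 hv (Finset.ne_of_mem_erase hν)]
      ring
  rw [key]
  ring

lemma deltaF_smul (c : ℂ) (v : Fin 6 → ℂ) (ν : ℕ) : deltaF ν (c • v) = c ^ 6 * deltaF ν v := by
  simp only [deltaF, Gs_smul, mul_add, Finset.mul_sum]
  congr 1
  · ring
  · exact Finset.sum_congr rfl fun j _ => by ring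

lemma deltaInf_smul (c : ℂ) (v : Fin 6 → ℂ) : deltaInf (c • v) = c ^ 6 * deltaInf v := by
  simp only [deltaInf, Gs_smul]; ring

lemma Phi30_smul (c : ℂ) (v : Fin 6 → ℂ) : Phi30 (c • v) = c ^ 30 * Phi30 v := by
  simp only [Phi30, deltaF_smul, deltaInf_smul, mul_pow, ← pow_mul, ← Finset.mul_sum]
  ring

lemma twist_twist (μ ν : ZMod 13) (v : ZMod 13 → ℂ) :
    twist μ (twist ν v) = twist (μ + ν) v := by
  ext x
  simp only [twist, add_mul, AddChar.map_add_eq_mul]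
  ring

lemma Phi30_twist (μ : ZMod 13) (v : ZMod 13 → ℂ) :
    Phi30 (coords (twist (7 * μ) v)) = Phi30 (coords v) := by
  have hsum (f : ℕ → ℂ) : ∑ ν ∈ Finset.range 13, f ν = ∑ ν : ZMod 13, f ν.val :=
    Finset.sum_range f
  have h (ν : ZMod 13) :
      deltaF ν.val (coords (twist (7 * μ) v)) = deltaF (ν + μ).val (coords v) := by
    rw [← deltaF_zero_twist, twist_twist, ← mul_add, deltaF_zero_twist]
  rw [Phi30, Phi30, hsum, hsum, deltaInf, deltaInf, Gs_zero_twist]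
  simp only [h]
  rw [← Equiv.sum_comp (Equiv.addRight μ) fun ν : ZMod 13 => deltaF ν.val (coords v) ^ 5]
  rfl

/-- The polynomial in `s` whose values at `ζ ^ ν * s` give the forms `δ_ν` of scaled arguments, with
coefficients depending on the pair formed by `u = s ^ 13` and the argument. -/
def deltaPoly (e : ℂ × (Fin 6 → ℂ)) : Polynomial ℂ :=
  ∑ j ∈ Finset.range 13, Polynomial.C ((if j = 0 then -13 else 1) * sexticNormalized e.1 e.2 j) *
    Polynomial.X ^ sexticOrder j

lemma continuous_cubicNormalized (j : ℕ) :
    Continuous fun e : ℂ × (Fin 6 → ℂ) => cubicNormalized e.1 e.2 j := by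
  rcases lt_or_ge j 14 with hj | hj
  · interval_cases j <;> simp only [cubicNormalized] <;> fun_prop
  · obtain ⟨k, rfl⟩ := Nat.exists_eq_add_of_le' hj
    simpa [cubicNormalized] using continuous_const

lemma continuous_sexticNormalized (j : ℕ) :
    Continuous fun e : ℂ × (Fin 6 → ℂ) => sexticNormalized e.1 e.2 j := by
  have h := continuous_cubicNormalized
  rcases lt_or_ge j 13 with hj | hj
  · have h0 := h 0
    have h1 := h 1
    have h2 := h 2
    have h3 := h 3
    have h4 := h 4
    have h5 := h 5
    have h6 := h 6
    have h7 := h 7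
    have h8 := h 8
    have h9 := h 9
    have h10 := h 10
    have h11 := h 11
    have h12 := h 12
    have h13 := h 13
    interval_cases j <;> simp only [sexticNormalized, sexticOfCubic] <;> fun_prop
  · obtain ⟨k, rfl⟩ := Nat.exists_eq_add_of_le' hj
    simpa [sexticNormalized, sexticOfCubic] using continuous_const

lemma continuous_coeff_deltaPoly (n : ℕ) : Continuous fun e => (deltaPoly e).coeff n := by
  simp only [deltaPoly, Polynomial.finsetSum_coeff, Polynomial.coeff_C_mul]
  exact continuous_finsetSum _ fun j _ =>
    ((continuous_const.mul (continuous_sexticNormalized j)).mul continuous_const)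

lemma continuous_coeff_pow {α : Type*} [TopologicalSpace α] {P : α → Polynomial ℂ}
    (hP : ∀ n, Continuous fun e => (P e).coeff n) (k n : ℕ) :
    Continuous fun e => (P e ^ k).coeff n := by
  induction k generalizing n with
  | zero => simpa using continuous_const
  | succ k ih =>
    simp only [pow_succ, Polynomial.coeff_mul]
    exact continuous_finsetSum _ fun i _ => (ih _).mul (hP _)

lemma natDegree_deltaPoly_pow_lt (e : ℂ × (Fin 6 → ℂ)) : (deltaPoly e ^ 5).natDegree < 117 := by
  have h : (deltaPoly e).natDegree ≤ 22 := by
    refine Polynomial.natDegree_sum_le_of_forall_le _ _ fun j hj => ?_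
    refine (Polynomial.natDegree_C_mul_X_pow_le _ _).trans ?_
    rw [Finset.mem_range] at hj
    interval_cases j <;> simp [sexticOrder]
  have := Polynomial.natDegree_pow_le (p := deltaPoly e) (n := 5)
  omega

lemma deltaF_scaling (s : ℂ) (y : Fin 6 → ℂ) (ν : ℕ) :
    deltaF ν (scaling s y) = ζ ^ (4 * ν) * (deltaPoly (s ^ 13, y)).eval (ζ ^ ν * s) := by
  have hζ : (ζ ^ ν) ^ 13 = 1 := by
    rw [← pow_mul, mul_comm, pow_mul, zeta13_isPrimitiveRoot.pow_eq_one, one_pow]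
  have hj (j : ℕ) (hj : j < 13) :
      ζ ^ (4 * ν) * (ζ ^ ν * s) ^ sexticOrder j = ζ ^ (j * ν) * s ^ sexticOrder j := by
    rw [mul_pow, ← mul_assoc, mul_comm 4 ν, mul_comm j ν, pow_mul, pow_mul, ← pow_add]
    congr 1
    generalize ζ ^ ν = t at *
    interval_cases j <;> simp only [sexticOrder]
    · linear_combination (t ^ 13 + 1) * hζ
    · linear_combination t * hζ
    · linear_combination t ^ 2 * hζ
    · linear_combination t ^ 3 * hζ
  have h : deltaF ν (scaling s y) = ∑ j ∈ Finset.range 13,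
      ζ ^ (j * ν) * ((if j = 0 then -13 else 1) * Gs j (scaling s y)) := by
    rw [deltaF, Finset.range_eq_Ico, Finset.sum_eq_sum_Ico_succ_bot (by norm_num)]
    congr 1
    · simp
    · refine Finset.sum_congr rfl fun j hj => ?_
      have : j ≠ 0 := by rw [Finset.mem_Ico] at hj; omega
      simp [this]
  rw [h, deltaPoly, Polynomial.eval_finsetSum, Finset.mul_sum]
  refine Finset.sum_congr rfl fun j hjm => ?_
  rw [Finset.mem_range] at hjm
  rw [Gs_scaling s y j hjm, Polynomial.eval_mul, Polynomial.eval_C, Polynomial.eval_pow,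
    Polynomial.eval_X]
  linear_combination (-(if j = 0 then -13 else 1) * sexticNormalized (s ^ 13) y j) * hj j hjm

lemma sum_zeta13_pow (n : ℕ) :
    ∑ ν ∈ Finset.range 13, (ζ ^ n) ^ ν = if 13 ∣ n then 13 else 0 := by
  split_ifs with h
  · rw [(zeta13_isPrimitiveRoot.pow_eq_one_iff_dvd n).mpr h]
    simp
  · have h1 : ζ ^ n ≠ 1 := fun h1 => h ((zeta13_isPrimitiveRoot.pow_eq_one_iff_dvd n).mp h1)
    rw [geom_sum_eq h1, ← pow_mul, mul_comm, pow_mul, zeta13_isPrimitiveRoot.pow_eq_one, one_pow,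
      sub_self, zero_div]

lemma sum_deltaF_pow_scaling (s : ℂ) (y : Fin 6 → ℂ) :
    ∑ ν ∈ Finset.range 13, deltaF ν (scaling s y) ^ 5 = ∑ n ∈ Finset.range 117,
      if 13 ∣ n + 20 then 13 * (deltaPoly (s ^ 13, y) ^ 5).coeff n * s ^ n else 0 := by
  have h (ν : ℕ) : deltaF ν (scaling s y) ^ 5 = ∑ n ∈ Finset.range 117,
      (ζ ^ (n + 20)) ^ ν * ((deltaPoly (s ^ 13, y) ^ 5).coeff n * s ^ n) := by
    rw [deltaF_scaling, mul_pow, ← Polynomial.eval_pow,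
      Polynomial.eval_eq_sum_range' (natDegree_deltaPoly_pow_lt _), Finset.mul_sum]
    refine Finset.sum_congr rfl fun n _ => ?_
    rw [mul_pow, ← pow_mul ζ ν n]
    ring
  simp only [h]
  rw [Finset.sum_comm]
  refine Finset.sum_congr rfl fun n _ => ?_
  rw [← Finset.sum_mul, sum_zeta13_pow]
  split_ifs <;> ring

/-- The limits at the cusp of the theta constants, normalized by their leading powers of `q`. -/
def cuspVector : Fin 6 → ℂ := ![1, 1, 1, -1, 1, 1]

lemma coeff_deltaPoly_cusp : ((deltaPoly (0, cuspVector)) ^ 5).coeff 6 = -1315 := by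
  have h (n : ℕ) : (deltaPoly (0, cuspVector)).coeff n = ∑ j ∈ Finset.range 13,
      if n = sexticOrder j then
        (if j = 0 then -13 else 1) * sexticNormalized 0 cuspVector j else 0 := by
    simp only [deltaPoly, Polynomial.finsetSum_coeff, Polynomial.coeff_C_mul_X_pow]
  have h0 : (deltaPoly (0, cuspVector)).coeff 0 = -1 := by
    rw [h]; simp [Finset.sum_range_succ, sexticOrder, sexticNormalized, sexticOfCubic,
      cubicNormalized, cuspVector]
  have h1 : (deltaPoly (0, cuspVector)).coeff 1 = 2 := by
    rw [h]; simp [Finset.sum_range_succ, sexticOrder, sexticNormalized, sexticOfCubic,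
      cubicNormalized, cuspVector]
  have h2 : (deltaPoly (0, cuspVector)).coeff 2 = 2 := by
    rw [h]; simp [Finset.sum_range_succ, sexticOrder, sexticNormalized, sexticOfCubic,
      cubicNormalized, cuspVector]; norm_num
  have h3 : (deltaPoly (0, cuspVector)).coeff 3 = -2 := by
    rw [h]; simp [Finset.sum_range_succ, sexticOrder, sexticNormalized, sexticOfCubic,
      cubicNormalized, cuspVector]; norm_num
  have h4 : (deltaPoly (0, cuspVector)).coeff 4 = -8 := by
    rw [h]; simp [Finset.sum_range_succ, sexticOrder, sexticNormalized, sexticOfCubic,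
      cubicNormalized, cuspVector]; norm_num
  have h5 : (deltaPoly (0, cuspVector)).coeff 5 = 6 := by
    rw [h]; simp [Finset.sum_range_succ, sexticOrder, sexticNormalized, sexticOfCubic,
      cubicNormalized, cuspVector]; norm_num
  have h6 : (deltaPoly (0, cuspVector)).coeff 6 = 1 := by
    rw [h]; simp [Finset.sum_range_succ, sexticOrder, sexticNormalized, sexticOfCubic,
      cubicNormalized, cuspVector]; norm_num
  generalize deltaPoly (0, cuspVector) = P at *
  rw [show P ^ 5 = (P * P) * (P * P) * P by ring]
  simp only [Polynomial.coeff_mul, Finset.Nat.sum_antidiagonal_eq_sum_range_succ_mk,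
    Finset.sum_range_succ, Finset.sum_range_zero]
  simp only [Nat.reduceSub, Nat.sub_zero, Nat.sub_self, h0, h1, h2, h3, h4, h5, h6]
  norm_num

/-- The leading behaviour of `Φ30` along the weighted scaling. -/
lemma exists_Phi30_scaling : ∃ R : ℂ × (Fin 6 → ℂ) → ℂ, Continuous R ∧ R (0, cuspVector) = 1 ∧
    ∀ s y, Phi30 (scaling s y) = s ^ 6 * R (s, y) := by
  refine ⟨fun e => -(1 / (13 * 1315)) * ((∑ n ∈ Finset.range 117,
    if 13 ∣ n + 20 then 13 * (deltaPoly (e.1 ^ 13, e.2) ^ 5).coeff n * e.1 ^ (n - 6) else 0) +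
      (13 ^ 2 * sexticNormalized (e.1 ^ 13) e.2 0) ^ 5 * e.1 ^ 104), ?_, ?_, ?_⟩
  · have hm : Continuous fun e : ℂ × (Fin 6 → ℂ) => (e.1 ^ 13, e.2) := by fun_prop
    have hc (n : ℕ) : Continuous fun e : ℂ × (Fin 6 → ℂ) =>
        (deltaPoly (e.1 ^ 13, e.2) ^ 5).coeff n :=
      (continuous_coeff_pow continuous_coeff_deltaPoly 5 n).comp hm
    have hs : Continuous fun e : ℂ × (Fin 6 → ℂ) => sexticNormalized (e.1 ^ 13) e.2 0 :=
      (continuous_sexticNormalized 0).comp hm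
    refine continuous_const.mul (Continuous.add (continuous_finsetSum _ fun n _ => ?_) ?_)
    · split_ifs
      · exact (continuous_const.mul (hc n)).mul (continuous_fst.pow _)
      · exact continuous_const
    · fun_prop
  · have h6 : (∑ n ∈ Finset.range 117, if 13 ∣ n + 20 then
        13 * (deltaPoly (0, cuspVector) ^ 5).coeff n * 0 ^ (n - 6) else 0) = 13 * -1315 := by
      rw [Finset.sum_eq_single 6]
      · simp [coeff_deltaPoly_cusp]
      · intro n _ hn
        split_ifs with hd
        · rw [zero_pow (by omega), mul_zero]
        · rfl
      · simp
    simp only [ne_eq, OfNat.ofNat_ne_zero, not_false_eq_true, zero_pow, mul_zero, add_zero]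
    rw [h6]
    norm_num
  · intro s y
    have hinf : deltaInf (scaling s y) ^ 5 =
        s ^ 6 * ((13 ^ 2 * sexticNormalized (s ^ 13) y 0) ^ 5 * s ^ 104) := by
      rw [deltaInf, Gs_scaling s y 0 (by norm_num), sexticOrder]
      ring
    rw [Phi30, sum_deltaF_pow_scaling, hinf]
    rw [mul_left_comm (s ^ 6) (-(1 / (13 * 1315))), mul_add (s ^ 6), Finset.mul_sum]
    congr 2
    refine Finset.sum_congr rfl fun n _ => ?_
    split_ifs with hd
    · rw [mul_left_comm, ← pow_add, Nat.add_sub_cancel' (by omega)]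
    · rw [mul_zero]

/-- The theta function of odd characteristic `x` and order 13. -/
def thetaOdd (x : ℤ) (z : ℂ) : ℂ :=
  cexp (Real.pi * I * (x : ℂ) ^ 2 * z / 52) * jacobiTheta₂ (1 / 2 + (x : ℂ) * z / 2) (13 * z)

/-- The theta functions of order 13 as a function on residue classes modulo 13. -/
def thetaVec (z : ℂ) (k : ZMod 13) : ℂ := (-1) ^ k.val * thetaOdd (2 * (k.val : ℤ) + 13) z

lemma cexp_pi_I_int (n : ℤ) : cexp (Real.pi * I * n) = (-1) ^ n := by
  rw [mul_comm, exp_int_mul, exp_pi_mul_I]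

lemma thetaSum_eq_jacobiTheta₂ (c : ℤ) (z : ℂ) :
    thetaSum c z = jacobiTheta₂ (1 / 2 + (c : ℂ) * z / 2) (13 * z) := by
  refine tsum_congr fun n => ?_
  rw [← cexp_pi_I_int, qp, jacobiTheta₂_term, ← Complex.exp_add]
  congr 1
  push_cast
  ring

lemma thetaOdd_eq (x : ℤ) (α : ℚ) (h : α = (x : ℚ) ^ 2 / 104) (z : ℂ) :
    thetaOdd x z = qp α z * thetaSum x z := by
  rw [thetaOdd, thetaSum_eq_jacobiTheta₂, qp, h]
  congr 2
  push_cast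
  ring

lemma thetaOdd_neg (x : ℤ) (z : ℂ) : thetaOdd (-x) z = thetaOdd x z := by
  rw [thetaOdd, thetaOdd, ← jacobiTheta₂_neg_left, ← jacobiTheta₂_add_left]
  push_cast
  congr 2 <;> ring

lemma thetaOdd_add (x : ℤ) (z : ℂ) : thetaOdd (x + 26) z = -thetaOdd x z := by
  have h : (1 / 2 + ((x + 26 : ℤ) : ℂ) * z / 2) = 1 / 2 + (x : ℂ) * z / 2 + 13 * z := by
    push_cast; ring
  rw [thetaOdd, thetaOdd, h, jacobiTheta₂_add_left', ← mul_assoc, ← Complex.exp_add, ← neg_mul]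
  congr 1
  have : Real.pi * I * ((x + 26 : ℤ) : ℂ) ^ 2 * z / 52 +
      -Real.pi * I * (13 * z + 2 * (1 / 2 + (x : ℂ) * z / 2)) =
      Real.pi * I * (x : ℂ) ^ 2 * z / 52 - Real.pi * I := by push_cast; ring
  rw [this, Complex.exp_sub, exp_pi_mul_I, div_neg, div_one]

lemma odd_thetaVec (z : ℂ) : (thetaVec z).Odd := by
  intro k
  rcases eq_or_ne k 0 with rfl | hk
  · have h := thetaOdd_add (-13) z
    rw [thetaOdd_neg] at h
    simp only [neg_zero, thetaVec, ZMod.val_zero]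
    norm_num at h ⊢
    exact h
  · have hlt := ZMod.val_lt k
    have h2 := thetaOdd_add (13 - 2 * k.val) z
    have h1 := thetaOdd_neg (13 - 2 * k.val) z
    have h3 := thetaOdd_add (-(13 - 2 * k.val)) z
    have e : (2 * ((13 - k.val : ℕ) : ℤ) + 13) = 13 - 2 * k.val + 26 := by
      push_cast [hlt.le]; ring
    have e' : (2 * (k.val : ℤ) + 13) = -(13 - 2 * k.val) + 26 := by ring
    have hs : (-1 : ℂ) ^ (13 - k.val) = -(-1) ^ k.val := by
      have : (-1 : ℂ) ^ (13 - k.val) * (-1) ^ k.val = -1 := by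
        rw [← pow_add, Nat.sub_add_cancel hlt.le]; norm_num
      have h' : ((-1 : ℂ) ^ k.val) * (-1) ^ k.val = 1 := by rw [← mul_pow]; norm_num
      linear_combination (-1 : ℂ) ^ k.val * this - (-1 : ℂ) ^ (13 - k.val) * h'
    simp only [thetaVec]
    rw [ZMod.neg_val, if_neg hk, e, e', h2, h3, h1, hs]
    ring

lemma X_eq_coords (z : ℂ) : X z = coords (etaF z • thetaVec z) := by
  have h1 := thetaOdd_add (-11) z
  have h2 := thetaOdd_add (-7) z
  rw [thetaOdd_neg] at h1 h2
  have v1 : thetaVec z 1 = thetaOdd 11 z := by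
    change (-1 : ℂ) ^ 1 * thetaOdd (-11 + 26) z = _
    rw [h1]; ring
  have v2 : thetaVec z 3 = thetaOdd 7 z := by
    change (-1 : ℂ) ^ 3 * thetaOdd (-7 + 26) z = _
    rw [h2]; ring
  have v3 : thetaVec z 9 = thetaOdd 5 z := by
    change (-1 : ℂ) ^ 9 * thetaOdd (5 + 26) z = _
    rw [thetaOdd_add]; ring
  have v4 : thetaVec z 8 = -thetaOdd 3 z := by
    change (-1 : ℂ) ^ 8 * thetaOdd (3 + 26) z = _
    rw [thetaOdd_add]; ring
  have v5 : thetaVec z 11 = thetaOdd 9 z := by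
    change (-1 : ℂ) ^ 11 * thetaOdd (9 + 26) z = _
    rw [thetaOdd_add]; ring
  have v6 : thetaVec z 7 = thetaOdd 1 z := by
    change (-1 : ℂ) ^ 7 * thetaOdd (1 + 26) z = _
    rw [thetaOdd_add]; ring
  rw [coords_smul, coords, v1, v2, v3, v4, v5, v6,
    thetaOdd_eq 11 (121 / 104) (by norm_num), thetaOdd_eq 7 (49 / 104) (by norm_num),
    thetaOdd_eq 5 (25 / 104) (by norm_num), thetaOdd_eq 3 (9 / 104) (by norm_num),
    thetaOdd_eq 9 (81 / 104) (by norm_num), thetaOdd_eq 1 (1 / 104) (by norm_num)]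
  ext i
  fin_cases i <;> rfl

lemma jacobiTheta₂_add_right_odd (w τ : ℂ) (n : ℤ) :
    jacobiTheta₂ (w + n + 1 / 2) (τ + (2 * n + 1)) = jacobiTheta₂ w τ := by
  refine tsum_congr fun m => ?_
  rw [jacobiTheta₂_term, jacobiTheta₂_term, Complex.exp_eq_exp_iff_exists_int]
  obtain ⟨k, hk⟩ := Int.even_mul_succ_self m
  refine ⟨m * n + m ^ 2 * n + k, ?_⟩
  have hk' : (m : ℂ) * (m + 1) = k + k := by exact_mod_cast hk
  push_cast
  linear_combination (Real.pi * I) * hk'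

lemma thetaVec_add_one (z : ℂ) :
    thetaVec (z + 1) = cexp (13 * Real.pi * I / 4) • twist (7 * 1) (thetaVec z) := by
  ext k
  have hk : ((7 * 1 * k ^ 2 : ZMod 13)) = ((7 * k.val ^ 2 : ℕ) : ZMod 13) := by simp
  have h1 : jacobiTheta₂ (1 / 2 + ((2 * (k.val : ℤ) + 13 : ℤ) : ℂ) * (z + 1) / 2) (13 * (z + 1)) =
      jacobiTheta₂ (1 / 2 + ((2 * (k.val : ℤ) + 13 : ℤ) : ℂ) * z / 2) (13 * z) := by
    have hp := Function.Periodic.int_mul (f := fun w => jacobiTheta₂ w (13 * z))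
      (fun w => jacobiTheta₂_add_left w _) k.val
      (1 / 2 + ((2 * (k.val : ℤ) + 13 : ℤ) : ℂ) * z / 2)
    simp only [mul_one] at hp
    rw [← hp, ← jacobiTheta₂_add_right_odd _ (13 * z) 6]
    push_cast
    congr 1 <;> ring
  have hz : cexp (Real.pi * I * ((2 * (k.val : ℤ) + 13 : ℤ) : ℂ) ^ 2 * (z + 1) / 52) =
      cexp (13 * Real.pi * I / 4) * zeta13 ^ (7 * k.val ^ 2) *
        cexp (Real.pi * I * ((2 * (k.val : ℤ) + 13 : ℤ) : ℂ) ^ 2 * z / 52) := by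
    rw [zeta13, ← Complex.exp_nat_mul, ← Complex.exp_add, ← Complex.exp_add,
      Complex.exp_eq_exp_iff_exists_int]
    obtain ⟨m, hm⟩ := Int.even_mul_succ_self (k.val : ℤ)
    refine ⟨m - (k.val : ℤ) ^ 2, ?_⟩
    have hm' : (k.val : ℂ) * (k.val + 1) = m + m := by exact_mod_cast hm
    push_cast
    linear_combination (Real.pi * I) * hm'
  simp only [Pi.smul_apply, smul_eq_mul, twist, thetaVec, thetaOdd]
  rw [hk, psi_natCast, h1, hz]
  ring

lemma dft13_thetaVec {z : ℂ} (hz : 0 < z.im) (k : ZMod 13) :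
    dft13 (thetaVec z) k =
      cexp (13 * Real.pi * I * z / 4) * jacobiTheta₂ (1 / 2 + k.val / 13 + z / 2) (z / 13) := by
  have him : 0 < (z / 13).im := by
    have : (z / 13).im = z.im / 13 := by
      rw [show (13 : ℂ) = ((13 : ℝ) : ℂ) by norm_num, div_ofReal_im]
    rw [this]; positivity
  have hs := (summable_jacobiTheta₂_term_iff (1 / 2 + k.val / 13 + z / 2) (z / 13)).mpr him
  let e := (Equiv.prodComm (Fin 13) ℤ).trans (Int.divModEquiv 13).symm
  have hse := e.summable_iff.mpr hs
  rw [Function.comp_def] at hse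
  rw [jacobiTheta₂, ← e.tsum_eq, hse.tsum_prod, tsum_fintype, Finset.mul_sum, dft13]
  refine Finset.sum_congr rfl fun l _ => ?_
  simp only [thetaVec, thetaOdd, jacobiTheta₂]
  simp only [← tsum_mul_left]
  refine tsum_congr fun n => ?_
  have hl : l.val = (show Fin 13 from l).val := rfl
  have he : e (l, n) = n * 13 + (l.val : ℤ) := rfl
  have hψ : ψ (k * l) = ζ ^ (k.val * l.val) := by
    rw [← psi_natCast]; simp
  have h1 : (-1 : ℂ) ^ l.val = cexp (Real.pi * I * (l.val : ℤ)) := by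
    rw [cexp_pi_I_int, zpow_natCast]
  rw [he, hψ, h1, jacobiTheta₂_term, jacobiTheta₂_term, zeta13, ← Complex.exp_nat_mul,
    ← Complex.exp_add, ← Complex.exp_add, ← Complex.exp_add, ← Complex.exp_add,
    Complex.exp_eq_exp_iff_exists_int]
  refine ⟨-n * k.val - 6 * n, ?_⟩
  push_cast
  ring

lemma thetaVec_neg_inv {z : ℂ} (hz : 0 < z.im) :
    thetaVec (-1 / z) = (I * (-I * (z / 13)) ^ (1 / 2 : ℂ)) • dft13 (thetaVec z) := by
  have hz0 : z ≠ 0 := by rintro rfl; simp at hz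
  ext k
  rw [Pi.smul_apply, dft13_thetaVec hz, jacobiTheta₂_functional_equation, thetaVec, thetaOdd,
    smul_eq_mul]
  have hr : (-I * (z / 13)) ^ (1 / 2 : ℂ) ≠ 0 := by
    rw [Ne, Complex.cpow_eq_zero_iff]; simp [hz0]
  have hJ : jacobiTheta₂ ((1 / 2 + k.val / 13 + z / 2) / (z / 13)) (-1 / (z / 13)) =
      jacobiTheta₂ (1 / 2 + ((2 * (k.val : ℤ) + 13 : ℤ) : ℂ) * (-1 / z) / 2) (13 * (-1 / z)) := by
    rw [← jacobiTheta₂_neg_left (1 / 2 + _)]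
    have hp := Function.Periodic.int_mul (f := fun w => jacobiTheta₂ w (13 * (-1 / z)))
      (fun w => jacobiTheta₂_add_left w _) 7
      (-(1 / 2 + ((2 * (k.val : ℤ) + 13 : ℤ) : ℂ) * (-1 / z) / 2))
    simp only [mul_one] at hp
    rw [← hp]
    push_cast
    congr 1
    · field_simp
      ring
    · field_simp
  have hE : (-1 : ℂ) ^ k.val *
      cexp (Real.pi * I * ((2 * (k.val : ℤ) + 13 : ℤ) : ℂ) ^ 2 * (-1 / z) / 52) =
      I * (cexp (13 * Real.pi * I * z / 4) *
        cexp (-Real.pi * I * (1 / 2 + k.val / 13 + z / 2) ^ 2 / (z / 13))) := by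
    have h1 : (-1 : ℂ) ^ k.val = cexp (Real.pi * I * (k.val : ℤ)) := by
      rw [cexp_pi_I_int, zpow_natCast]
    rw [h1]
    nth_rw 3 [← exp_pi_div_two_mul_I]
    rw [← Complex.exp_add, ← Complex.exp_add, ← Complex.exp_add,
      Complex.exp_eq_exp_iff_exists_int]
    refine ⟨k.val + 3, ?_⟩
    push_cast
    field_simp
    ring
  rw [hJ, ← mul_assoc, hE]
  generalize jacobiTheta₂ _ _ = J
  generalize cexp (13 * Real.pi * I * z / 4) = E₁
  generalize cexp (_ / _) = E₂
  field_simp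

lemma etaF_eq_eta (z : ℂ) : etaF z = ModularForm.eta z := by
  rw [etaF, ModularForm.eta, qp, Function.Periodic.qParam]
  congr 1
  · congr 1
    push_cast
    ring
  · exact tprod_congr fun n => by rw [ModularForm.eta_q_eq_pow]

lemma etaF_add_one (z : ℂ) : etaF (z + 1) = cexp (Real.pi * I / 12) * etaF z := by
  have h : cexp (2 * Real.pi * I * (z + 1)) = cexp (2 * Real.pi * I * z) := by
    rw [mul_add, mul_one, Complex.exp_add, exp_two_pi_mul_I, mul_one]
  rw [etaF, etaF, h, ← mul_assoc, qp, qp, ← Complex.exp_add]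
  congr 2
  push_cast
  ring

lemma Phi30_X (z : ℂ) : Phi30 (X z) = etaF z ^ 30 * Phi30 (coords (thetaVec z)) := by
  rw [X_eq_coords, coords_smul, Phi30_smul]

lemma Phi30_X_add_one (z : ℂ) : Phi30 (X (z + 1)) = Phi30 (X z) := by
  have h : cexp (Real.pi * I / 12) ^ 30 * cexp (13 * Real.pi * I / 4) ^ 30 = 1 := by
    rw [← Complex.exp_nat_mul, ← Complex.exp_nat_mul, ← Complex.exp_add,
      Complex.exp_eq_one_iff]
    exact ⟨50, by push_cast; ring⟩
  rw [Phi30_X, Phi30_X, thetaVec_add_one, coords_smul, Phi30_smul, Phi30_twist, etaF_add_one]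
  linear_combination etaF z ^ 30 * Phi30 (coords (thetaVec z)) * h

lemma cpow_half_pow_thirty (w : ℂ) : (w ^ (1 / 2 : ℂ)) ^ 30 = w ^ 15 := by
  rw [← cpow_nat_mul, show ((30 : ℕ) : ℂ) * (1 / 2) = (15 : ℕ) by norm_num, cpow_natCast]

lemma Phi30_X_neg_inv {z : ℂ} (hz : 0 < z.im) : Phi30 (X (-1 / z)) = z ^ 30 * Phi30 (X z) := by
  have hz0 : z ≠ 0 := by rintro rfl; simp at hz
  have he : etaF (-1 / z) = (sqrt I)⁻¹ * (sqrt z * etaF z) := by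
    simpa [etaF_eq_eta] using ModularForm.eta_comp_eq_csqrt_I_inv hz
  have hs (w : ℂ) : sqrt w ^ 30 = w ^ 15 := by
    rw [← cpow_half_pow_thirty, one_div, sqrt]
  rw [Phi30_X, Phi30_X, thetaVec_neg_inv hz, coords_smul, Phi30_smul, Phi30_dft13 (odd_thetaVec z),
    he]
  simp only [mul_pow, inv_pow]
  rw [cpow_half_pow_thirty, hs, hs]
  have hI : I ^ 15 = -I := by
    rw [show 15 = 4 * 3 + 3 by norm_num, pow_add, pow_mul, I_pow_four, one_pow, one_mul, I_pow_three]
  have hI' : I ^ 30 = -1 := by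
    rw [show 30 = 15 * 2 by norm_num, pow_mul, hI, neg_sq, I_sq]
  have h13 : (-I * (z / 13)) ^ 15 = I * z ^ 15 / 13 ^ 15 := by
    rw [mul_pow, div_pow, Odd.neg_pow (by decide), hI]; ring
  rw [hI', h13, hI, inv_neg, inv_I]
  field_simp
  linear_combination -(etaF z ^ 30 * Phi30 (coords (thetaVec z))) * I_sq

lemma norm_qp (α : ℚ) (z : ℂ) : ‖qp α z‖ = Real.exp (-(2 * Real.pi * α * z.im)) := by
  rw [qp, Complex.norm_exp]
  congr 1
  simp [Complex.mul_re, Complex.mul_im]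

lemma qp_mul_qp (α β : ℚ) (z : ℂ) : qp α z * qp β z = qp (α + β) z := by
  rw [qp, qp, qp, ← Complex.exp_add]
  congr 1
  push_cast
  ring

lemma qp_pow (α : ℚ) (n : ℕ) (z : ℂ) : qp α z ^ n = qp (n * α) z := by
  rw [qp, qp, ← Complex.exp_nat_mul]
  congr 1
  push_cast
  ring

lemma qp_zero (z : ℂ) : qp 0 z = 1 := by simp [qp]

lemma qp_ne_zero (α : ℚ) (z : ℂ) : qp α z ≠ 0 := Complex.exp_ne_zero _

open UpperHalfPlane Filter Topology in
lemma tendsto_qp_atImInfty {α : ℚ} (hα : 0 < α) :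
    Tendsto (fun τ : ℍ => qp α τ) atImInfty (𝓝 0) := by
  rw [tendsto_zero_iff_norm_tendsto_zero]
  simp only [norm_qp]
  refine Real.tendsto_exp_neg_atTop_nhds_zero.comp ?_
  have : Tendsto (fun τ : ℍ => τ.im) atImInfty atTop := tendsto_comap
  exact this.const_mul_atTop (by positivity)

open UpperHalfPlane Filter Topology in
lemma tendsto_thetaSum_atImInfty {c : ℤ} (hc : |c| ≤ 11) :
    Tendsto (fun τ : ℍ => thetaSum c τ) atImInfty (𝓝 1) := by
  have hexp (n : ℤ) : (n.natAbs : ℚ) ≤ (13 * (n : ℚ) ^ 2 + (c : ℚ) * (n : ℚ)) / 2 := by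
    have h : 2 * (n.natAbs : ℤ) ≤ 13 * n ^ 2 + c * n := by
      have h1 : -(11 * |n|) ≤ c * n := by
        have := neg_abs_le (c * n)
        rw [abs_mul] at this
        nlinarith [abs_nonneg n]
      have h2 : |n| ≤ n ^ 2 := by
        rw [← sq_abs]
        exact Int.le_self_sq _
      rw [Int.natCast_natAbs]
      linarith
    have h' := Int.cast_le (R := ℚ).mpr h
    rw [Int.cast_mul, Int.cast_natCast] at h'
    simp only [Int.cast_add, Int.cast_mul, Int.cast_pow, Int.cast_ofNat] at h'
    linarith
  have hlim : ∑' n : ℤ, (if n = 0 then (1 : ℂ) else 0) = 1 := tsum_ite_eq 0 _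
  rw [← hlim]
  refine tendsto_tsum_of_dominated_convergence (bound := fun n : ℤ => Real.exp (-1) ^ n.natAbs)
    ?_ ?_ ?_
  · have hs : Summable fun n : ℕ => Real.exp (-1) ^ n :=
      summable_geometric_of_lt_one (Real.exp_nonneg _) (by simp)
    exact Summable.of_nat_of_neg (by simp) (by simp)
  · intro n
    split_ifs with hn
    · subst hn
      simp [qp_zero]
    · have hpos : (0 : ℚ) < (13 * (n : ℚ) ^ 2 + (c : ℚ) * (n : ℚ)) / 2 :=
        lt_of_lt_of_le (by exact_mod_cast Int.natAbs_pos.mpr hn) (hexp n)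
      simpa using (tendsto_qp_atImInfty hpos).const_mul ((-1 : ℂ) ^ n)
  · have him : ∀ᶠ τ : ℍ in atImInfty, 1 ≤ τ.im :=
      (tendsto_comap : Tendsto UpperHalfPlane.im atImInfty atTop).eventually_ge_atTop 1
    filter_upwards [him] with τ hτ n
    rw [norm_mul, norm_zpow, norm_neg, norm_one, one_zpow, one_mul, norm_qp, ← Real.exp_nat_mul,
      Real.exp_le_exp, mul_neg, neg_le_neg_iff, mul_one]
    have h1 : (n.natAbs : ℝ) ≤ (((13 * (n : ℚ) ^ 2 + (c : ℚ) * (n : ℚ)) / 2 : ℚ) : ℝ) := by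
      exact_mod_cast hexp n
    have h0 : (0 : ℝ) ≤ n.natAbs := by positivity
    have hpi : 1 ≤ 2 * Real.pi := by linarith [Real.pi_gt_three]
    calc (n.natAbs : ℝ) ≤ _ := h1
      _ = 1 * (((13 * (n : ℚ) ^ 2 + (c : ℚ) * (n : ℚ)) / 2 : ℚ) : ℝ) * 1 := by ring
      _ ≤ _ := by
        have := h0.trans h1
        have hτ' : 1 ≤ (τ : ℂ).im := hτ
        gcongr

/-- The Euler product `∏ (1 - q^n)`. -/
def eulerProd (z : ℂ) : ℂ := ∏' n : ℕ, (1 - cexp (2 * Real.pi * I * z) ^ (n + 1))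

open UpperHalfPlane Filter Topology in
lemma tendsto_eulerProd_atImInfty :
    Tendsto (fun τ : ℍ => eulerProd τ) atImInfty (𝓝 1) := by
  have htprod : Tendsto (fun q : ℂ => ∏' n : ℕ, (1 - q ^ (n + 1))) (𝓝 0) (𝓝 1) := by
    have := tendsto_tprod_one_add_of_dominated_convergence (𝓕 := 𝓝 0) (g := 0)
      (f := fun (q : ℂ) (n : ℕ) ↦ -q ^ (n + 1)) (bound := fun n ↦ (1 / 2 : ℝ) ^ (n + 1))
    simp only [Pi.zero_apply, norm_neg, norm_pow, add_zero, tprod_one] at this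
    simp_rw [sub_eq_add_neg]
    refine this
      (by simpa only [pow_succ'] using (summable_geometric_of_abs_lt_one (by norm_num)).mul_left _)
      (fun k ↦ by simpa using ((continuous_pow (M := ℂ) (k + 1)).tendsto 0).neg) ?_
    filter_upwards [Metric.ball_mem_nhds (0 : ℂ) (by norm_num : (0 : ℝ) < 1 / 2)] with q hq k
    exact pow_le_pow_left₀ (norm_nonneg _) (by simpa using (mem_ball_zero_iff.mp hq).le) _
  refine htprod.comp ((tendsto_qp_atImInfty one_pos).congr fun τ => ?_)
  simp [qp]

/-- The normalized theta constants. -/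
def thetaNormalized (z : ℂ) : Fin 6 → ℂ :=
  ![thetaSum 11 z, thetaSum 7 z, thetaSum 5 z, -thetaSum 3 z, thetaSum 9 z, thetaSum 1 z]

lemma X_eq_scaling (z : ℂ) :
    X z = qp (1 / 24 + 1 / 104) z • scaling (qp (1 / 13) z) (eulerProd z • thetaNormalized z) := by
  have h (α : ℚ) (n : ℕ) (t : ℂ) (hα : 1 / 24 + α = 1 / 24 + 1 / 104 + n * (1 / 13)) :
      qp (1 / 24) z * eulerProd z * (qp α z * t) =
        qp (1 / 24 + 1 / 104) z * (qp (1 / 13) z ^ n * (eulerProd z * t)) := by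
    rw [qp_pow, ← mul_assoc (qp (1 / 24 + 1 / 104) z), qp_mul_qp, ← hα, ← qp_mul_qp]
    ring
  ext i
  fin_cases i
  · exact h (121 / 104) 15 _ (by norm_num)
  · exact h (49 / 104) 6 _ (by norm_num)
  · exact h (25 / 104) 3 _ (by norm_num)
  · have := h (9 / 104) 1 (-thetaSum 3 z) (by norm_num)
    rw [pow_one, mul_neg] at this
    exact this
  · exact h (81 / 104) 10 _ (by norm_num)
  · have := h (1 / 104) 0 (thetaSum 1 z) (by norm_num)
    rw [pow_zero, one_mul] at this
    exact this

lemma Delta_sq_eq (z : ℂ) : Delta z ^ 2 = qp 2 z * eulerProd z ^ 48 := by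
  rw [Delta, etaF, ← eulerProd, ← pow_mul, mul_pow, qp_pow]
  norm_num

open UpperHalfPlane Filter Topology in
lemma tendsto_Phi30_div_Delta_sq :
    Tendsto (fun τ : ℍ => Phi30 (X τ) / Delta τ ^ 2) atImInfty (𝓝 1) := by
  obtain ⟨R, hR, hR1, hRs⟩ := exists_Phi30_scaling
  have heq (τ : ℍ) : Phi30 (X τ) / Delta τ ^ 2 =
      R (qp (1 / 13) τ, eulerProd τ • thetaNormalized τ) / eulerProd τ ^ 48 := by
    rw [X_eq_scaling, Phi30_smul, hRs, Delta_sq_eq, ← mul_assoc, qp_pow, qp_pow, qp_mul_qp]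
    norm_num
    rw [mul_div_mul_left _ _ (qp_ne_zero _ _)]
  simp only [heq]
  have hθ : Tendsto (fun τ : ℍ => thetaNormalized τ) atImInfty (𝓝 cuspVector) := by
    rw [tendsto_pi_nhds]
    intro i
    fin_cases i
    · exact tendsto_thetaSum_atImInfty (by norm_num)
    · exact tendsto_thetaSum_atImInfty (by norm_num)
    · exact tendsto_thetaSum_atImInfty (by norm_num)
    · exact (tendsto_thetaSum_atImInfty (by norm_num)).neg
    · exact tendsto_thetaSum_atImInfty (by norm_num)
    · exact tendsto_thetaSum_atImInfty (by norm_num)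
  have hy : Tendsto (fun τ : ℍ => eulerProd τ • thetaNormalized τ) atImInfty (𝓝 cuspVector) := by
    simpa using tendsto_eulerProd_atImInfty.smul hθ
  have hRt := (hR.tendsto (0, cuspVector)).comp
    ((tendsto_qp_atImInfty (α := 1 / 13) (by norm_num)).prodMk_nhds hy)
  rw [hR1] at hRt
  have h := hRt.div (tendsto_eulerProd_atImInfty.pow 48) (by norm_num)
  rw [one_pow, div_one] at h
  exact h

lemma differentiable_D (j : ℕ) : Differentiable ℂ (D j) := by
  rcases lt_or_ge j 13 with hj | hj
  · interval_cases j <;> unfold D <;> fun_prop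
  · obtain ⟨k, rfl⟩ := Nat.exists_eq_add_of_le' hj
    exact differentiable_const 0

lemma differentiable_Dinf : Differentiable ℂ Dinf := by
  unfold Dinf
  fun_prop

lemma differentiable_Gs (j : ℕ) : Differentiable ℂ (Gs j) := by
  have h := differentiable_D
  have h' := differentiable_Dinf
  rcases lt_or_ge j 13 with hj | hj
  · interval_cases j <;> unfold Gs <;> fun_prop
  · obtain ⟨k, rfl⟩ := Nat.exists_eq_add_of_le' hj
    exact differentiable_const 0

lemma differentiable_Phi30 : Differentiable ℂ Phi30 := by
  have h := differentiable_Gs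
  have hδ (ν : ℕ) : Differentiable ℂ (deltaF ν) := by
    unfold deltaF
    fun_prop
  unfold Phi30 deltaInf
  fun_prop

lemma differentiableAt_thetaOdd (x : ℤ) {z : ℂ} (hz : 0 < z.im) :
    DifferentiableAt ℂ (thetaOdd x) z := by
  have him : 0 < (13 * z).im := by simpa using hz
  have hJ := (hasFDerivAt_jacobiTheta₂ (1 / 2 + (x : ℂ) * z / 2) him).differentiableAt
  have hJ' : DifferentiableAt ℂ
      (fun z : ℂ => jacobiTheta₂ (1 / 2 + (x : ℂ) * z / 2) (13 * z)) z :=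
    hJ.comp z (f := fun z : ℂ => (1 / 2 + (x : ℂ) * z / 2, 13 * z)) (by fun_prop)
  unfold thetaOdd
  fun_prop

lemma differentiableAt_etaF {z : ℂ} (hz : 0 < z.im) : DifferentiableAt ℂ etaF z := by
  rw [funext etaF_eq_eta]
  exact ModularForm.differentiableAt_eta_of_mem_upperHalfPlaneSet hz

lemma differentiableAt_Phi30_X {z : ℂ} (hz : 0 < z.im) :
    DifferentiableAt ℂ (fun z => Phi30 (X z)) z := by
  have hθ (k : ZMod 13) : DifferentiableAt ℂ (fun z => thetaVec z k) z :=
    (differentiableAt_thetaOdd _ hz).const_mul _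
  have hη := differentiableAt_etaF hz
  have hX : DifferentiableAt ℂ X z := by
    rw [funext X_eq_coords, differentiableAt_pi]
    intro i
    fin_cases i <;> exact hη.mul (hθ _)
  exact differentiable_Phi30.differentiableAt.comp z hX

open UpperHalfPlane in
lemma Delta_eq_discriminant (τ : ℍ) : Delta τ = ModularForm.discriminant τ := by
  rw [Delta, etaF_eq_eta, ModularForm.discriminant]

open UpperHalfPlane in
/-- The quotient of `Φ30(x1, …, x6)` by `Δ^2` on the upper half-plane. -/
def phiQuotient (τ : ℍ) : ℂ := Phi30 (X τ) / Delta τ ^ 2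

open UpperHalfPlane ModularForm in
lemma phiQuotient_slash_T : phiQuotient ∣[(6 : ℤ)] ModularGroup.T = phiQuotient := by
  ext τ
  have hΔ : Delta (τ + 1) = Delta τ := by
    have h : cexp (Real.pi * Complex.I / 12) ^ 24 = 1 := by
      rw [← Complex.exp_nat_mul, Complex.exp_eq_one_iff]
      exact ⟨1, by push_cast; ring⟩
    rw [Delta, etaF_add_one, mul_pow, h, one_mul, Delta]
  have hd : denom ModularGroup.T τ = 1 := by
    rw [ModularGroup.denom_apply]
    simp [ModularGroup.T]
  rw [SL_slash_apply, hd, modular_T_smul, phiQuotient, phiQuotient]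
  have hc : (((1 : ℝ) +ᵥ τ : ℍ) : ℂ) = τ + 1 := by simp [add_comm]
  rw [hc, Phi30_X_add_one, hΔ]
  simp

lemma sqrt_pow_twenty_four (w : ℂ) : Complex.sqrt w ^ 24 = w ^ 12 := by
  rw [Complex.sqrt, ← cpow_nat_mul, ← cpow_natCast]
  norm_num

open UpperHalfPlane ModularForm in
lemma phiQuotient_slash_S : phiQuotient ∣[(6 : ℤ)] ModularGroup.S = phiQuotient := by
  ext τ
  have hτ : (τ : ℂ) ≠ 0 := UpperHalfPlane.ne_zero τ
  have hΔ : Delta (-1 / τ) = (τ : ℂ) ^ 12 * Delta τ := by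
    have he : etaF (-1 / τ) = (Complex.sqrt Complex.I)⁻¹ * (Complex.sqrt τ * etaF τ) := by
      simpa [etaF_eq_eta] using ModularForm.eta_comp_eq_csqrt_I_inv τ.2
    rw [Delta, he, mul_pow, mul_pow, inv_pow, sqrt_pow_twenty_four, sqrt_pow_twenty_four, Delta,
      show (12 : ℕ) = 2 * 6 by rfl, pow_mul, Complex.I_sq]
    ring
  rw [SL_slash_apply, UpperHalfPlane.modular_S_smul, ModularGroup.denom_S, phiQuotient,
    phiQuotient]
  have hc : ((UpperHalfPlane.mk (-(τ : ℂ))⁻¹ τ.im_inv_neg_coe_pos : ℍ) : ℂ) = -1 / τ := by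
    simp [neg_div]
  rw [hc, Phi30_X_neg_inv τ.im_pos, hΔ]
  have hD : Delta τ ≠ 0 := by rw [Delta_eq_discriminant]; exact discriminant_ne_zero τ
  rw [zpow_neg, show (6 : ℤ) = (6 : ℕ) by rfl, zpow_natCast]
  field_simp

open UpperHalfPlane ModularForm MatrixGroups in
/-- The quotient of `Φ30(x1, …, x6)` by `Δ^2` as a modular form of weight six. -/
def phiForm : ModularForm 𝒮ℒ 6 where
  toFun := phiQuotient
  slash_action_eq' A hA := by
    obtain ⟨A, rfl⟩ := hA
    exact SlashInvariantForm.slash_action_generators_SL2Z phiQuotient_slash_S phiQuotient_slash_T A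
  holo' := by
    rw [UpperHalfPlane.mdifferentiable_iff]
    refine .congr (f := fun z => Phi30 (X z) / Delta z ^ 2) (fun z hz => ?_) fun z hz => ?_
    · have hΔ : Delta z ^ 2 ≠ 0 := by
        rw [Delta, etaF_eq_eta]
        exact pow_ne_zero _ (pow_ne_zero _ (eta_ne_zero hz))
      exact ((differentiableAt_Phi30_X hz).div (((differentiableAt_etaF hz).pow 24).pow 2)
        hΔ).differentiableWithinAt
    · simp [phiQuotient, ofComplex_apply_of_im_pos hz]
  bdd_at_cusps' hc := by
    rw [Subgroup.IsArithmetic.isCusp_iff_isCusp_SL2Z] at hc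
    rw [OnePoint.isBoundedAt_iff_forall_SL2Z hc]
    intro γ _
    rw [SlashInvariantForm.slash_action_generators_SL2Z phiQuotient_slash_S phiQuotient_slash_T]
    exact tendsto_Phi30_div_Delta_sq.isBigO_one ℝ

open UpperHalfPlane in
lemma E₆_apply_eq_E6 (τ : ℍ) : ModularForm.E₆ τ = E6 τ := by
  let e : {p : ℤ × ℤ // Int.gcd p.1 p.2 = 1} ≃ EisensteinSeries.gammaSet 1 1 0 :=
    (finTwoArrowEquiv ℤ).symm.subtypeEquiv fun p => by
      rw [EisensteinSeries.gammaSet_one_mem_iff]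
      rfl
  change (1 / 2 : ℂ) * eisensteinSeries 0 6 τ = _
  rw [E6, eisensteinSeries, ← e.tsum_eq]
  rfl

open UpperHalfPlane ModularForm MatrixGroups in
lemma phiQuotient_eq_E₆ (τ : ℍ) : phiQuotient τ = E₆ τ := by
  obtain ⟨c, hc⟩ : ∃ c : ℂ, c • E₆ = phiForm :=
    (finrank_eq_one_iff_of_nonzero' E₆ (EisensteinSeries.E_ne_zero _ ⟨3, rfl⟩)).mp
      (Module.rank_eq_one_iff_finrank_eq_one.mp levelOne_weight_six_rank_one) _
  have h1 : (qExpansion 1 phiForm).coeff 0 = 1 := by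
    rw [qExpansion_coeff_zero one_pos
      (ModularFormClass.analyticAt_cuspFunction_zero phiForm one_pos one_mem_strictPeriods_SL)
      (SlashInvariantFormClass.periodic_comp_ofComplex phiForm one_mem_strictPeriods_SL)]
    exact tendsto_Phi30_div_Delta_sq.limUnder_eq
  rw [← hc, FunLike.coe_smul, ModularForm.qExpansion_smul one_pos one_mem_strictPeriods_SL c
    E₆] at h1
  have h2 := EisensteinSeries.E_qExpansion_coeff_zero (k := 6) (by norm_num) ⟨3, rfl⟩
  simp [h2] at h1
  rw [← one_smul ℂ (E₆ τ), ← h1]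
  exact (DFunLike.congr_fun hc τ).symm

/-- `Φ30(x1(z),…,x6(z)) = Δ(z)^2·E6(z)` on ℍ. -/
theorem stmt_17 (z : ℂ) (hz : 0 < z.im) : Phi30 (X z) = Delta z ^ 2 * E6 z := by
  have h := phiQuotient_eq_E₆ ⟨z, hz⟩
  rw [E₆_apply_eq_E6, phiQuotient, div_eq_iff] at h
  · rw [mul_comm]
    exact h
  · rw [Delta_eq_discriminant]
    exact pow_ne_zero _ (ModularForm.discriminant_ne_zero _)

end
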